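/- Let T, Q be finite sets, w ≥ 0, and let A and B be integer T×Q-matrices that are equivalent over ℤ. Then A^{≀w}(s,s) and B^{≀w}(s,s) are equivalent over ℤ. -/

import Mathlib

open scoped BigOperators
open Classical

noncomputable section

/-- The number of maps `f` from the (indexed) parts of `mu` to the parts of `lam` such that for
every part `lam_i` of `lam`, the sum of the parts of `mu` in the fibre `f⁻¹(i)` equals `lam_i`.
This is `|𝓜_{λμ}|` and also the value of the permutation character `h_λ` on the class of cycle
type `μ`. -/
def Mcount (lam mu : Multiset ℕ) : ℕ :=
  Fintype.card {f : Fin (Multiset.card mu) → Fin (Multiset.card lam) //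
    ∀ i : Fin (Multiset.card lam),
      (∑ j ∈ Finset.univ.filter (fun j => f j = i), (mu.sort (· ≤ ·)).getD j 0)
        = (lam.sort (· ≤ ·)).getD i 0}

/-- `z_λ = ∏_i i^{m_i(λ)} m_i(λ)!`. -/
def zMult (lam : Multiset ℕ) : ℕ :=
  ∏ i ∈ lam.toFinset, i ^ lam.count i * (lam.count i).factorial

/-- The cycle type of a permutation of `Fin n`, as the multiset of parts of a partition of `n`
(including the parts equal to `1` corresponding to fixed points). -/
def cycM {n : ℕ} (g : Equiv.Perm (Fin n)) : Multiset ℕ :=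
  g.cycleType + Multiset.replicate (n - g.support.card) 1

/-- The value of the irreducible character `s_λ` of the symmetric group on the conjugacy class
of cycle type `nu`, given by the Jacobi–Trudi determinant `s_λ = det(h_{λ_i - i + j})_{i,j}`,
where `h_α` has value `Mcount α ν` on the class of cycle type `ν`. -/
def sval (lam nu : Multiset ℕ) : ℚ :=
  let L := (lam.sort (· ≤ ·)).reverse
  let l := Multiset.card lam
  ∑ σ : Equiv.Perm (Fin l),
    ((Equiv.Perm.sign σ : ℤ) : ℚ) *
      (if ∀ i : Fin l, (i : ℕ) ≤ L.getD i 0 + (σ i : ℕ) then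
        (Mcount ((Multiset.map (fun i : Fin l => L.getD i 0 + (σ i : ℕ) - (i : ℕ))
            (Finset.univ.val : Multiset (Fin l))).filter (fun x => x ≠ 0)) nu : ℚ)
       else 0)

/-- The irreducible character of `S_n` labelled by the partition `lam`, as a class function on
the symmetric group `S_n = Perm (Fin n)`. -/
def sFun {n : ℕ} (lam : Nat.Partition n) : Equiv.Perm (Fin n) → ℚ :=
  fun g => sval lam.parts (cycM g)

/-- The usual scalar product of class functions on a finite group:
`⟨f, h⟩ = |G|⁻¹ ∑_{g ∈ G} f(g) h(g⁻¹)`. -/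
def sp {G : Type*} [Group G] [Fintype G] (f h : G → ℚ) : ℚ :=
  (Fintype.card G : ℚ)⁻¹ * ∑ g : G, f g * h g⁻¹

/-- The class function `p_λ` on `S_w`: `p_λ(g_μ) = z_λ δ_{λμ}`. -/
def pFun {w : ℕ} (lam : Nat.Partition w) : Equiv.Perm (Fin w) → ℚ :=
  fun g => if cycM g = lam.parts then (zMult lam.parts : ℚ) else 0

/-- The class function `p̃_λ = z_λ⁻¹ p_λ` on `S_w`: the indicator of the class of type `λ`. -/
def ptFun {w : ℕ} (lam : Nat.Partition w) : Equiv.Perm (Fin w) → ℚ :=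
  fun g => if cycM g = lam.parts then 1 else 0

/-- The induced class function along an injection `ι : H → G` (underlying a subgroup inclusion):
`Ind φ (g) = |H|⁻¹ ∑_{x ∈ G} ∑_{h ∈ H, ι(h) = x g x⁻¹} φ(h)`. -/
def IndFun {H G : Type*} [Fintype H] [Fintype G] [Group G] (ι : H → G) (φ : H → ℚ) :
    G → ℚ :=
  fun g => (Fintype.card H : ℚ)⁻¹ * ∑ x : G, ∑ h : H, if ι h = x * g * x⁻¹ then φ h else 0

/-- A bijection `Σ_i Fin (w_i) ≃ Fin w` when `∑_i w_i = w`, realising `Fin w` as the disjoint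
union of blocks of sizes `w_i`. -/
def embSigma {η : Type*} [Fintype η] (ws : η → ℕ) {w : ℕ} (h : ∑ i, ws i = w) :
    (Σ i, Fin (ws i)) ≃ Fin w :=
  Fintype.equivOfCardEq (by simp [h])

/-- The type of all partitions (of arbitrary natural numbers). -/
abbrev PttAll : Type := Σ n : ℕ, Nat.Partition n

/-- Partitions of size at most `w`, with bounded first component (a finite type). -/
abbrev PBP (w : ℕ) : Type := (m : Fin (w + 1)) × Nat.Partition m

/-- `PMap_w(T)`: the (finite) set of maps from `T` to partitions, of total size `w`. -/
abbrev PMapw (T : Type*) [Fintype T] (w : ℕ) : Type _ :=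
  {lam : T → PBP w // ∑ t, ((lam t).1 : ℕ) = w}

/-- The scalar product on `Λ_ℚ = ⊕_w CF(S_w)` of two graded elements (the graded components
being orthogonal, this is zero when the degrees differ). -/
def pairCF {a b : ℕ} (f : Equiv.Perm (Fin a) → ℚ) (g : Equiv.Perm (Fin b) → ℚ) : ℚ :=
  if h : a = b then sp f (fun σ => g ((finCongr h).permCongr σ)) else 0

/-- The product in `Λ_ℚ` of a finite family of graded class functions: the class function on
`S_w` induced from the outer tensor product on the Young subgroup `∏_i S_{w_i}`. -/
def multiProdCF {η : Type*} [Fintype η] (ws : η → ℕ) {w : ℕ} (h : ∑ i, ws i = w)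
    (fs : ∀ i, Equiv.Perm (Fin (ws i)) → ℚ) : Equiv.Perm (Fin w) → ℚ :=
  IndFun (fun (g : ∀ i, Equiv.Perm (Fin (ws i))) =>
      ((embSigma ws h).symm.trans
        ((Equiv.sigmaCongrRight (fun i => (g i : Fin (ws i) ≃ Fin (ws i)))).trans
          (embSigma ws h)) : Equiv.Perm (Fin w)))
    (fun g => ∏ i, fs i (g i))

/-- The `(λ̲, μ̲)`-entry of the matrix `A^{≀}(u, v)`:
`∑_{ν̲} (∏_t ⟨u_{λ̲(t)}, ∏_q p̃_{ν̲(t,q)}⟩) (∏_q ⟨v_{μ̲(q)}, ∏_t p_{ν̲(t,q)}⟩)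
  (∏_{t,q} A_{tq}^{l(ν̲(t,q))})`,
the sum running over all maps `ν̲` from `T × Q` to partitions. -/
def wrGen {T Q : Type*} [Fintype T] [Fintype Q]
    (u v : ∀ n : ℕ, Nat.Partition n → Equiv.Perm (Fin n) → ℚ)
    (A : T → Q → ℚ) (lam : T → PttAll) (mu : Q → PttAll) : ℚ :=
  ∑ᶠ nu : T × Q → PttAll,
    (∏ t : T, pairCF (u (lam t).1 (lam t).2)
        (multiProdCF (fun q => (nu (t, q)).1) rfl (fun q => ptFun (nu (t, q)).2))) *
    (∏ q : Q, pairCF (v (mu q).1 (mu q).2)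
        (multiProdCF (fun t => (nu (t, q)).1) rfl (fun t => pFun (nu (t, q)).2))) *
    (∏ t : T, ∏ q : Q, A t q ^ (Multiset.card (nu (t, q)).2.parts))

/-- The `(λ̲, μ̲)`-entry of the matrix `A^{≀}(s, s)`. -/
def wrS {T Q : Type*} [Fintype T] [Fintype Q] (A : T → Q → ℚ)
    (lam : T → PttAll) (mu : Q → PttAll) : ℚ :=
  wrGen (fun _ lam' => sFun lam') (fun _ lam' => sFun lam') A lam mu

/-- The matrix `A^{≀w}(s, s)`, the `PMap_w(T) × PMap_w(Q)`-submatrix of `A^{≀}(s, s)`. -/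
def wrSMat {T Q : Type*} [Fintype T] [Fintype Q] (A : T → Q → ℚ) (w : ℕ) :
    Matrix (PMapw T w) (PMapw Q w) ℚ :=
  Matrix.of fun lam mu =>
    wrS A (fun t => ⟨(lam.1 t).1, (lam.1 t).2⟩) (fun q => ⟨(mu.1 q).1, (mu.1 q).2⟩)

/-! ### Cycle types -/

lemma cycM_sum {n : ℕ} (g : Equiv.Perm (Fin n)) : (cycM g).sum = n := by
  have h := g.partition.parts_sum
  rw [Equiv.Perm.parts_partition] at h
  simpa [cycM] using h

lemma cycM_inv {n : ℕ} (g : Equiv.Perm (Fin n)) : cycM g⁻¹ = cycM g := by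
  simp [cycM]

lemma cycM_conj {n : ℕ} (g x : Equiv.Perm (Fin n)) : cycM (x * g * x⁻¹) = cycM g := by
  simp [cycM, Equiv.Perm.cycleType_conj]

lemma cycM_eq_iff {n : ℕ} (g : Equiv.Perm (Fin n)) (lam : Nat.Partition n) :
    cycM g = lam.parts ↔ g.cycleType = lam.parts.filter (fun x => 2 ≤ x) := by
  constructor
  · intro h
    have h2 := g.filter_parts_partition_eq_cycleType
    rw [Equiv.Perm.parts_partition] at h2
    rw [← h2, ← h]
    simp [cycM]
  · intro h
    have h3 : lam.parts = lam.parts.filter (fun x => 2 ≤ x)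
        + lam.parts.filter (fun x => ¬ 2 ≤ x) := (Multiset.filter_add_not _ _).symm
    have h4 : lam.parts.filter (fun x => ¬ 2 ≤ x)
        = Multiset.replicate (Multiset.card (lam.parts.filter (fun x => ¬ 2 ≤ x))) 1 := by
      rw [Multiset.eq_replicate_card]
      intro b hb
      rw [Multiset.mem_filter] at hb
      have := lam.parts_pos hb.1
      omega
    have h5 := congrArg Multiset.sum h3
    rw [lam.parts_sum, Multiset.sum_add, h4, Multiset.sum_replicate, ← h,
      Equiv.Perm.sum_cycleType] at h5
    simp only [smul_eq_mul, mul_one] at h5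
    unfold cycM
    rw [h3, h4, ← h]
    congr 2
    omega

lemma zMult_mul {n : ℕ} (lam : Nat.Partition n) :
    (Finset.univ.filter (fun g : Equiv.Perm (Fin n) => cycM g = lam.parts)).card
      * zMult lam.parts = n.factorial := by
  have h1 := Equiv.Perm.card_of_cycleType_mul_eq (Fin n) (lam.parts.filter (fun x => 2 ≤ x))
  have hs : (Finset.univ.filter (fun g : Equiv.Perm (Fin n) => cycM g = lam.parts))
      = Finset.univ.filter (fun g : Equiv.Perm (Fin n) =>
        g.cycleType = lam.parts.filter (fun x => 2 ≤ x)) := by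
    ext g
    simp [cycM_eq_iff]
  have h3 : lam.parts = lam.parts.filter (fun x => 2 ≤ x)
      + lam.parts.filter (fun x => ¬ 2 ≤ x) := (Multiset.filter_add_not _ _).symm
  have h4 : lam.parts.filter (fun x => ¬ 2 ≤ x)
      = Multiset.replicate (Multiset.count 1 lam.parts) 1 := by
    rw [← Multiset.filter_eq']
    apply Multiset.filter_congr
    intro x hx
    have := lam.parts_pos hx
    omega
  have h5 := congrArg Multiset.sum h3
  rw [lam.parts_sum, Multiset.sum_add, h4, Multiset.sum_replicate] at h5
  simp only [smul_eq_mul, mul_one] at h5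
  rw [if_pos] at h1
  swap
  · constructor
    · simp; omega
    · intro a ha
      exact (Multiset.mem_filter.1 ha).2
  rw [hs]
  simp only [Fintype.card_fin] at h1
  refine Eq.trans ?_ h1
  congr 1
  have h6 : n - (lam.parts.filter (fun x => 2 ≤ x)).sum = Multiset.count 1 lam.parts := by omega
  rw [h6, Finset.prod_multiset_count, mul_assoc, ← Finset.prod_mul_distrib]
  have h7 : (lam.parts.filter (fun x => 2 ≤ x)).toFinset = lam.parts.toFinset.erase 1 := by
    ext x
    simp only [Multiset.mem_toFinset, Multiset.mem_filter, Finset.mem_erase]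
    constructor
    · rintro ⟨h, h'⟩; exact ⟨by omega, h⟩
    · rintro ⟨h, h'⟩
      have := lam.parts_pos h'
      exact ⟨h', by omega⟩
  rw [h7]
  unfold zMult
  have h8 : ∏ x ∈ lam.parts.toFinset.erase 1,
      x ^ Multiset.count x (lam.parts.filter (fun x => 2 ≤ x)) *
        (Multiset.count x (lam.parts.filter (fun x => 2 ≤ x))).factorial
      = ∏ x ∈ lam.parts.toFinset.erase 1,
        x ^ Multiset.count x lam.parts * (Multiset.count x lam.parts).factorial := by
    apply Finset.prod_congr rfl
    intro x hx
    simp only [Multiset.mem_toFinset, Finset.mem_erase] at hx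
    have := lam.parts_pos hx.2
    rw [Multiset.count_filter_of_pos (by omega)]
  rw [h8]
  by_cases h1m : 1 ∈ lam.parts.toFinset
  · rw [← Finset.mul_prod_erase _ _ h1m]; simp
  · rw [Finset.erase_eq_of_notMem h1m]
    have : Multiset.count 1 lam.parts = 0 := by simpa using h1m
    simp [this]

lemma zMult_pos {n : ℕ} (lam : Nat.Partition n) : 0 < zMult lam.parts := by
  rcases Nat.eq_zero_or_pos (zMult lam.parts) with h | h
  · have := zMult_mul lam
    rw [h, mul_zero] at this
    exact absurd this.symm (Nat.factorial_ne_zero n)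
  · exact h

/-- The embedding of the Young subgroup. -/
def youngEmb {η : Type*} [Fintype η] (ws : η → ℕ) {w : ℕ} (h : ∑ i, ws i = w)
    (g : ∀ i, Equiv.Perm (Fin (ws i))) : Equiv.Perm (Fin w) :=
  ((embSigma ws h).symm.trans
        ((Equiv.sigmaCongrRight (fun i => (g i : Fin (ws i) ≃ Fin (ws i)))).trans
          (embSigma ws h)) : Equiv.Perm (Fin w))

lemma youngEmb_apply {η : Type*} [Fintype η] (ws : η → ℕ) {w : ℕ} (h : ∑ i, ws i = w)
    (g : ∀ i, Equiv.Perm (Fin (ws i))) (i : η) (x : Fin (ws i)) :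
    youngEmb ws h g (embSigma ws h ⟨i, x⟩) = embSigma ws h ⟨i, g i x⟩ := by
  simp [youngEmb]

lemma youngEmb_mul {η : Type*} [Fintype η] (ws : η → ℕ) {w : ℕ} (h : ∑ i, ws i = w)
    (g k : ∀ i, Equiv.Perm (Fin (ws i))) :
    youngEmb ws h (g * k) = youngEmb ws h g * youngEmb ws h k := by
  ext y
  obtain ⟨⟨i, x⟩, rfl⟩ := (embSigma ws h).surjective y
  simp [youngEmb_apply]

lemma youngEmb_one {η : Type*} [Fintype η] (ws : η → ℕ) {w : ℕ} (h : ∑ i, ws i = w) :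
    youngEmb ws h 1 = 1 := by
  ext y
  obtain ⟨⟨i, x⟩, rfl⟩ := (embSigma ws h).surjective y
  simp [youngEmb_apply]

lemma youngEmb_disjoint {η : Type*} [Fintype η] (ws : η → ℕ) {w : ℕ} (h : ∑ i, ws i = w)
    (g k : ∀ i, Equiv.Perm (Fin (ws i))) (hgk : ∀ i, g i = 1 ∨ k i = 1) :
    (youngEmb ws h g).Disjoint (youngEmb ws h k) := by
  intro y
  obtain ⟨⟨i, x⟩, rfl⟩ := (embSigma ws h).surjective y
  simp only [youngEmb_apply]
  rcases hgk i with h | h <;> simp [h]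

lemma youngEmb_single {η : Type*} [Fintype η] (ws : η → ℕ) {w : ℕ} (h : ∑ i, ws i = w)
    (i : η) (g : Equiv.Perm (Fin (ws i))) :
    (youngEmb ws h (Pi.mulSingle i g)).cycleType = g.cycleType := by
  let f : Fin (ws i) ≃ {y : Fin w // ((embSigma ws h).symm y).1 = i} :=
    Equiv.ofBijective (fun x => ⟨embSigma ws h ⟨i, x⟩, by simp⟩) (by
      constructor
      · intro x y hxy
        simpa using hxy
      · rintro ⟨y, hy⟩
        obtain ⟨⟨j, x⟩, rfl⟩ := (embSigma ws h).surjective y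
        simp only [Equiv.symm_apply_apply] at hy
        subst hy
        exact ⟨x, rfl⟩)
  rw [← Equiv.Perm.cycleType_extendDomain f (g := g)]
  congr 1
  ext y
  obtain ⟨⟨j, x⟩, rfl⟩ := (embSigma ws h).surjective y
  rw [youngEmb_apply]
  by_cases hj : j = i
  · subst hj
    have : embSigma ws h ⟨j, x⟩ = (f x : Fin w) := rfl
    rw [this, Equiv.Perm.extendDomain_apply_image]
    simp [f]
    rfl
  · rw [Equiv.Perm.extendDomain_apply_not_subtype]
    · simp [Pi.mulSingle_eq_of_ne hj]
    · simpa using hj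

lemma youngEmb_cycleType {η : Type*} [Fintype η] (ws : η → ℕ) {w : ℕ} (h : ∑ i, ws i = w)
    (g : ∀ i, Equiv.Perm (Fin (ws i))) :
    (youngEmb ws h g).cycleType = ∑ i, (g i).cycleType := by
  have key : ∀ s : Finset η, (youngEmb ws h (fun i => if i ∈ s then g i else 1)).cycleType
      = ∑ i ∈ s, (g i).cycleType := by
    intro s
    induction s using Finset.induction_on with
    | empty =>
      have : (fun i => if i ∈ (∅ : Finset η) then g i else 1) = 1 := by ext; simp
      rw [this, youngEmb_one]; simp
    | insert i s hi ih =>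
      have : (fun j => if j ∈ insert i s then g j else 1)
          = Pi.mulSingle i (g i) * (fun j => if j ∈ s then g j else 1) := by
        funext j
        by_cases hj : j = i
        · subst hj; simp [hi]
        · simp [hj]
      rw [this, youngEmb_mul, Equiv.Perm.Disjoint.cycleType_mul, youngEmb_single, ih,
        Finset.sum_insert hi]
      apply youngEmb_disjoint
      intro j
      by_cases hj : j = i
      · subst hj; simp [hi]
      · left; simp [hj]
  have := key Finset.univ
  simpa using this

lemma youngEmb_cycM {η : Type*} [Fintype η] (ws : η → ℕ) {w : ℕ} (h : ∑ i, ws i = w)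
    (g : ∀ i, Equiv.Perm (Fin (ws i))) :
    cycM (youngEmb ws h g) = ∑ i, cycM (g i) := by
  have h1 : ∑ i, cycM (g i) = ∑ i, (g i).cycleType
      + Multiset.replicate (∑ i, (ws i - (g i).support.card)) 1 := by
    simp only [cycM, Finset.sum_add_distrib]
    congr 1
    exact (map_sum (Multiset.replicateAddMonoidHom 1) _ _).symm
  have h2 : (∑ i, cycM (g i)).sum = w := by
    have h3 := map_sum (Multiset.sumAddMonoidHom : Multiset ℕ →+ ℕ) (fun i => cycM (g i)) Finset.univ
    simp only [Multiset.coe_sumAddMonoidHom, cycM_sum] at h3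
    rw [h3, h]
  have h4 := cycM_sum (youngEmb ws h g)
  rw [h1] at h2 ⊢
  unfold cycM at h4 ⊢
  rw [youngEmb_cycleType] at h4 ⊢
  simp only [Multiset.sum_add, Multiset.sum_replicate, smul_eq_mul, mul_one] at h2 h4
  congr 2
  omega

lemma sp_IndFun {η : Type*} [Fintype η] (ws : η → ℕ) {w : ℕ} (h : ∑ i, ws i = w)
    (F : Multiset ℕ → ℚ) (nu : ∀ i, Nat.Partition (ws i)) (c : η → ℚ) :
    sp (fun g : Equiv.Perm (Fin w) => F (cycM g))
      (multiProdCF ws h (fun i g => if cycM g = (nu i).parts then c i else 0))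
      = F (∑ i, (nu i).parts) * ∏ i, (c i / zMult (nu i).parts) := by
  have hcard : ∀ i, (Finset.univ.filter
      (fun g : Equiv.Perm (Fin (ws i)) => cycM g = (nu i).parts)).card
      = ((ws i).factorial : ℚ) / zMult (nu i).parts := by
    intro i
    have := zMult_mul (nu i)
    have h2 : (zMult (nu i).parts : ℚ) ≠ 0 := by exact_mod_cast (zMult_pos (nu i)).ne'
    rw [eq_div_iff h2]
    exact_mod_cast this
  have hsum : ∑ g : (∀ i, Equiv.Perm (Fin (ws i))),
      (∏ i, (if cycM (g i) = (nu i).parts then c i else 0)) * F (cycM (youngEmb ws h g))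
      = F (∑ i, (nu i).parts) * ∏ i, (c i * (((ws i).factorial : ℚ) / zMult (nu i).parts)) := by
    have h1 : ∀ g : (∀ i, Equiv.Perm (Fin (ws i))),
      (∏ i, (if cycM (g i) = (nu i).parts then c i else 0)) * F (cycM (youngEmb ws h g))
       = (∏ i, (if cycM (g i) = (nu i).parts then c i else 0)) * F (∑ i, (nu i).parts) := by
      intro g
      by_cases hg : ∀ i, cycM (g i) = (nu i).parts
      · rw [youngEmb_cycM]; simp [hg]
      · push Not at hg
        obtain ⟨i, hi⟩ := hg
        rw [Finset.prod_eq_zero (Finset.mem_univ i) (by simp [hi])]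
        simp
    simp_rw [h1]
    rw [← Finset.sum_mul, mul_comm]
    congr 1
    rw [← Fintype.prod_sum (fun i (g : Equiv.Perm (Fin (ws i))) =>
      if cycM g = (nu i).parts then c i else 0)]
    apply Finset.prod_congr rfl
    intro i _
    rw [← Finset.sum_filter, Finset.sum_const, nsmul_eq_mul, hcard, mul_comm]
  have hswap : ∑ g : Equiv.Perm (Fin w), F (cycM g) * ∑ x : Equiv.Perm (Fin w),
      ∑ k : (∀ i, Equiv.Perm (Fin (ws i))),
        (@ite ℚ (youngEmb ws h k = x * g⁻¹ * x⁻¹) (propDecidable _)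
          (∏ i, (if cycM (k i) = (nu i).parts then c i else 0)) 0)
      = (Fintype.card (Equiv.Perm (Fin w)) : ℚ) * ∑ g : (∀ i, Equiv.Perm (Fin (ws i))),
      (∏ i, (if cycM (g i) = (nu i).parts then c i else 0)) * F (cycM (youngEmb ws h g)) := by
    simp_rw [Finset.mul_sum]
    rw [Finset.sum_comm]
    have : ∀ x : Equiv.Perm (Fin w), ∑ g : Equiv.Perm (Fin w),
      ∑ k : (∀ i, Equiv.Perm (Fin (ws i))), F (cycM g) *
        (@ite ℚ (youngEmb ws h k = x * g⁻¹ * x⁻¹) (propDecidable _)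
          (∏ i, (if cycM (k i) = (nu i).parts then c i else 0)) 0)
      = ∑ g : (∀ i, Equiv.Perm (Fin (ws i))),
      (∏ i, (if cycM (g i) = (nu i).parts then c i else 0)) * F (cycM (youngEmb ws h g)) := by
      intro x
      rw [Finset.sum_comm]
      apply Finset.sum_congr rfl
      intro k _
      rw [Finset.sum_eq_single (x⁻¹ * (youngEmb ws h k)⁻¹ * x)]
      · rw [if_pos (by group)]
        have : cycM (x⁻¹ * (youngEmb ws h k)⁻¹ * x) = cycM (youngEmb ws h k) := by
          have := cycM_conj (youngEmb ws h k)⁻¹ x⁻¹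
          rw [inv_inv] at this
          rw [this, cycM_inv]
        rw [this, mul_comm]
      · intro b _ hb
        rw [if_neg, mul_zero]
        intro hk
        apply hb
        rw [hk]; group
      · simp
    simp_rw [this]
    rw [Finset.sum_const, nsmul_eq_mul]
    rw [Finset.card_univ, Finset.mul_sum]
  have hG : (Fintype.card (Equiv.Perm (Fin w)) : ℚ) ≠ 0 := by
    exact_mod_cast Fintype.card_ne_zero
  unfold sp multiProdCF IndFun
  change (Fintype.card (Equiv.Perm (Fin w)) : ℚ)⁻¹ * ∑ g : Equiv.Perm (Fin w),
      F (cycM g) * ((Fintype.card (∀ i, Equiv.Perm (Fin (ws i))) : ℚ)⁻¹ *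
      ∑ x : Equiv.Perm (Fin w),
      ∑ k : (∀ i, Equiv.Perm (Fin (ws i))),
        (@ite ℚ (youngEmb ws h k = x * g⁻¹ * x⁻¹) (propDecidable _)
          (∏ i, (if cycM (k i) = (nu i).parts then c i else 0)) 0)) = _
  simp_rw [mul_left_comm (F _)]
  rw [← Finset.mul_sum, hswap, hsum, mul_left_comm, inv_mul_cancel_left₀ hG, mul_left_comm]
  congr 1
  rw [Fintype.card_pi, Nat.cast_prod, ← Finset.prod_inv_distrib, ← Finset.prod_mul_distrib]
  apply Finset.prod_congr rfl
  intro i _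
  rw [Fintype.card_perm, Fintype.card_fin]
  have : ((ws i).factorial : ℚ) ≠ 0 := by exact_mod_cast Nat.factorial_ne_zero _
  field_simp

lemma pairCF_gen {η : Type*} [Fintype η] (ws : η → ℕ) {a : ℕ}
    (F : Multiset ℕ → ℚ) (hF : ∀ m : Multiset ℕ, m.sum ≠ a → F m = 0)
    (nu : ∀ i, Nat.Partition (ws i)) (c : η → ℚ) :
    pairCF (fun g : Equiv.Perm (Fin a) => F (cycM g))
      (multiProdCF ws rfl (fun i g => if cycM g = (nu i).parts then c i else 0))
      = F (∑ i, (nu i).parts) * ∏ i, (c i / zMult (nu i).parts) := by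
  unfold pairCF
  split_ifs with h
  · subst h
    rw [← sp_IndFun ws rfl]
    rfl
  · rw [hF, zero_mul]
    have h3 := map_sum (Multiset.sumAddMonoidHom : Multiset ℕ →+ ℕ)
      (fun i => (nu i).parts) Finset.univ
    simp only [Multiset.coe_sumAddMonoidHom, Nat.Partition.parts_sum] at h3
    rw [h3]
    exact fun hh => h hh.symm

/-! ### The Jacobi-Trudi transition matrix -/

lemma univ_map_getD (l : List ℕ) (n : ℕ) (h : l.length = n) :
    (Finset.univ : Finset (Fin n)).val.map (fun i : Fin n => l.getD i 0) = (l : Multiset ℕ) := by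
  subst h
  rw [Fin.univ_val_map]
  congr 1
  apply List.ext_get
  · simp
  · intro n h1 h2
    simp

lemma univ_map_sort (m : Multiset ℕ) :
    (Finset.univ : Finset (Fin (Multiset.card m))).val.map
      (fun i : Fin (Multiset.card m) => (m.sort (· ≤ ·)).getD i 0) = m := by
  rw [univ_map_getD _ _ (by simp)]
  simp

lemma univ_map_rev (m : Multiset ℕ) :
    (Finset.univ : Finset (Fin (Multiset.card m))).val.map
      (fun i : Fin (Multiset.card m) => (m.sort (· ≤ ·)).reverse.getD i 0) = m := by
  rw [univ_map_getD _ _ (by simp)]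
  simp

lemma sum_sort (m : Multiset ℕ) (f : ℕ → ℕ) :
    ∑ i : Fin (Multiset.card m), f ((m.sort (· ≤ ·)).getD i 0) = (m.map f).sum := by
  conv_rhs => rw [← univ_map_sort m]
  rw [Multiset.map_map]
  rfl

lemma sum_rev (m : Multiset ℕ) (f : ℕ → ℕ) :
    ∑ i : Fin (Multiset.card m), f ((m.sort (· ≤ ·)).reverse.getD i 0) = (m.map f).sum := by
  conv_rhs => rw [← univ_map_rev m]
  rw [Multiset.map_map]
  rfl

lemma Mcount_eq_zero (lam mu : Multiset ℕ) (h : mu.sum ≠ lam.sum) : Mcount lam mu = 0 := by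
  unfold Mcount
  rw [Fintype.card_eq_zero_iff]
  constructor
  rintro ⟨f, hf⟩
  apply h
  have h1 := sum_sort lam (fun x => x)
  have h2 := sum_sort mu (fun x => x)
  rw [Multiset.map_id'] at h1 h2
  rw [← h1, ← h2, ← Finset.sum_fiberwise Finset.univ f]
  exact Finset.sum_congr rfl (fun i _ => hf i)

/-- the composition `λ_i - i + σ(i)`. -/
def jtc0 (lam : Multiset ℕ) (σ : Equiv.Perm (Fin (Multiset.card lam))) : Multiset ℕ :=
  (Multiset.map (fun i : Fin (Multiset.card lam) =>
    (lam.sort (· ≤ ·)).reverse.getD i 0 + (σ i : ℕ) - (i : ℕ))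
            (Finset.univ.val : Multiset (Fin (Multiset.card lam))))

/-- the composition with zeros removed. -/
def jtc (lam : Multiset ℕ) (σ : Equiv.Perm (Fin (Multiset.card lam))) : Multiset ℕ :=
  (jtc0 lam σ).filter (fun x => x ≠ 0)

/-- nonnegativity condition. -/
def jtcOk (lam : Multiset ℕ) (σ : Equiv.Perm (Fin (Multiset.card lam))) : Prop :=
  ∀ i : Fin (Multiset.card lam), (i : ℕ) ≤ (lam.sort (· ≤ ·)).reverse.getD i 0 + (σ i : ℕ)

/-- Coefficient of `h_κ` in `s_λ`. -/
def Kc (lam kap : Multiset ℕ) : ℤ :=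
  ∑ σ : Equiv.Perm (Fin (Multiset.card lam)),
    (Equiv.Perm.sign σ : ℤ) * (if jtcOk lam σ ∧ jtc lam σ = kap then 1 else 0)

lemma sval_def (lam nu : Multiset ℕ) : sval lam nu =
    ∑ σ : Equiv.Perm (Fin (Multiset.card lam)),
    ((Equiv.Perm.sign σ : ℤ) : ℚ) * (if jtcOk lam σ then (Mcount (jtc lam σ) nu : ℚ) else 0) := by
  unfold sval jtcOk jtc jtc0
  apply Finset.sum_congr rfl
  intro σ _
  congr!

lemma sum_map_filter_ne (m : Multiset ℕ) (f : ℕ → ℕ) (hf : f 0 = 0) :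
    ((m.filter (fun x => x ≠ 0)).map f).sum = (m.map f).sum := by
  induction m using Multiset.induction_on with
  | empty => simp
  | cons a s ih =>
    by_cases ha : a = 0
    · subst ha; simp [hf, ih]
    · rw [Multiset.filter_cons_of_pos (p := fun x => x ≠ 0) _ ha]; simp [ih]

lemma jtc_sum (lam : Multiset ℕ) (σ : Equiv.Perm (Fin (Multiset.card lam)))
    (h : jtcOk lam σ) : (jtc lam σ).sum = lam.sum := by
  have h1 := sum_map_filter_ne (jtc0 lam σ) (fun x => x) rfl
  rw [Multiset.map_id', Multiset.map_id'] at h1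
  unfold jtc
  rw [h1]
  have h2 := sum_rev lam (fun x => x)
  rw [Multiset.map_id'] at h2
  rw [← h2]
  have h3 : (jtc0 lam σ).sum = ∑ i : Fin (Multiset.card lam),
    ((lam.sort (· ≤ ·)).reverse.getD i 0 + (σ i : ℕ) - (i : ℕ)) := rfl
  rw [h3]
  have h4 : ∑ i : Fin (Multiset.card lam),
    ((lam.sort (· ≤ ·)).reverse.getD i 0 + (σ i : ℕ) - (i : ℕ)) + ∑ i : Fin (Multiset.card lam), (i : ℕ)
     = ∑ i : Fin (Multiset.card lam), (lam.sort (· ≤ ·)).reverse.getD i 0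
      + ∑ i : Fin (Multiset.card lam), (i : ℕ) := by
    conv_rhs => rw [← Equiv.sum_comp σ (fun i : Fin (Multiset.card lam) => (i : ℕ))]
    rw [← Finset.sum_add_distrib, ← Finset.sum_add_distrib]
    apply Finset.sum_congr rfl
    intro i _
    have := h i
    omega
  omega

/-- Sum of squares. -/
def sqs (m : Multiset ℕ) : ℕ := (m.map (fun x => x ^ 2)).sum

lemma rev_anti (lam : Multiset ℕ) (i j : Fin (Multiset.card lam)) (h : i < j) :
    (lam.sort (· ≤ ·)).reverse.getD j 0 ≤ (lam.sort (· ≤ ·)).reverse.getD i 0 := by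
  have h1 : (lam.sort (· ≤ ·)).reverse.Pairwise (fun a b => b ≤ a) :=
    List.pairwise_reverse.2 (lam.pairwise_sort (· ≤ ·))
  rw [List.pairwise_iff_getElem] at h1
  have hi : (i : ℕ) < (lam.sort (· ≤ ·)).reverse.length := by simp
  have hj : (j : ℕ) < (lam.sort (· ≤ ·)).reverse.length := by simp
  have := h1 i j hi hj h
  rw [List.getD_eq_getElem _ _ hi, List.getD_eq_getElem _ _ hj]
  exact this

lemma jtc_sq (lam : Multiset ℕ) (σ : Equiv.Perm (Fin (Multiset.card lam)))
    (h : jtcOk lam σ) (hσ : σ ≠ 1) : sqs lam < sqs (jtc lam σ) := by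
  unfold sqs jtc
  rw [sum_map_filter_ne _ _ (by simp), ← sum_rev lam]
  have h3 : ((jtc0 lam σ).map (fun x => x ^ 2)).sum = ∑ i : Fin (Multiset.card lam),
    ((lam.sort (· ≤ ·)).reverse.getD i 0 + (σ i : ℕ) - (i : ℕ)) ^ 2 := by
    unfold jtc0
    rw [Multiset.map_map]; rfl
  rw [h3]
  let f : Fin (Multiset.card lam) → ℤ := fun i => (lam.sort (· ≤ ·)).reverse.getD i 0 - (i : ℤ)
  let g : Fin (Multiset.card lam) → ℤ := fun i => (i : ℤ)
  have hf : StrictAnti f := by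
    intro i j hij
    have h1 := rev_anti lam i j hij
    have h2 : (i : ℕ) < j := hij
    simp only [f]
    omega
  have hfg : Antivary f g := by
    intro i j hij
    apply hf.antitone
    simp only [g] at hij
    exact le_of_lt (by exact_mod_cast hij)
  have key := (hfg.sum_mul_lt_sum_mul_comp_perm_iff (σ := σ)).2 (by
    intro hanti
    apply hσ
    have hm : StrictMono (σ⁻¹ : Equiv.Perm (Fin (Multiset.card lam))) := by
      intro a b hab
      have h1 := hanti (i := σ⁻¹ a) (j := σ⁻¹ b) (by simpa [g] using hab)
      have h2 := hf.le_iff_ge.1 h1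
      exact lt_of_le_of_ne h2 (by simpa using hab.ne)
    have h5 : σ⁻¹ = 1 := by
      have h6 := (hm.range_inj strictMono_id).1
        (by rw [(σ⁻¹).surjective.range_eq, Set.range_id])
      ext i
      rw [h6]; rfl
    simpa using h5)
  have h6 : ∑ i, (g (σ i)) ^ 2 = ∑ i, (g i) ^ 2 := Equiv.sum_comp σ (fun i => (g i) ^ 2)
  have h7 : ∀ i : Fin (Multiset.card lam),
      (((lam.sort (· ≤ ·)).reverse.getD i 0 + (σ i : ℕ) - (i : ℕ) : ℕ) : ℤ) ^ 2
      = f i ^ 2 + 2 * (f i * g (σ i)) + g (σ i) ^ 2 := by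
    intro i
    rw [Nat.cast_sub (h i)]
    simp only [f, g]
    push_cast
    ring
  have h8 : ∀ i : Fin (Multiset.card lam),
      (((lam.sort (· ≤ ·)).reverse.getD i 0 : ℕ) : ℤ) ^ 2
      = f i ^ 2 + 2 * (f i * g i) + g i ^ 2 := by
    intro i
    simp only [f, g]
    ring
  rw [← Nat.cast_lt (α := ℤ), Nat.cast_sum, Nat.cast_sum]
  simp_rw [Nat.cast_pow, h7, h8, Finset.sum_add_distrib, ← Finset.mul_sum, h6]
  simp only [smul_eq_mul] at key
  linarith

lemma jtc_one (lam : Multiset ℕ) (hl : ∀ x ∈ lam, x ≠ 0) : jtc lam 1 = lam := by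
  have : jtc0 lam 1 = lam := by
    unfold jtc0
    simp only [Equiv.Perm.coe_one, id_eq, Nat.add_sub_cancel]
    exact univ_map_rev lam
  unfold jtc
  rw [this]
  exact Multiset.filter_eq_self.2 hl

lemma Kc_diag (lam : Multiset ℕ) (hl : ∀ x ∈ lam, x ≠ 0) : Kc lam lam = 1 := by
  unfold Kc
  rw [Finset.sum_eq_single 1]
  · rw [if_pos]
    · simp
    · exact ⟨fun i => by simp, jtc_one lam hl⟩
  · intro σ _ hσ
    rw [if_neg, mul_zero]
    rintro ⟨h1, h2⟩
    have := jtc_sq lam σ h1 hσ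
    rw [h2] at this
    exact lt_irrefl _ this
  · simp

lemma Kc_ne (lam kap : Multiset ℕ) (hl : ∀ x ∈ lam, x ≠ 0) (h : Kc lam kap ≠ 0) :
    kap.sum = lam.sum ∧ (lam = kap ∨ sqs lam < sqs kap) := by
  unfold Kc at h
  obtain ⟨σ, _, hσ⟩ := Finset.exists_ne_zero_of_sum_ne_zero h
  split_ifs at hσ with h1
  · obtain ⟨h1, rfl⟩ := h1
    refine ⟨jtc_sum lam σ h1, ?_⟩
    by_cases hs : σ = 1
    · subst hs; left; exact (jtc_one lam hl).symm
    · right; exact jtc_sq lam σ h1 hs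
  · simp at hσ

lemma PBP_ext {w : ℕ} {a b : PBP w} (h : a.2.parts = b.2.parts) : a = b := by
  obtain ⟨m, p⟩ := a
  obtain ⟨n, q⟩ := b
  have h1 := p.parts_sum
  have h2 := q.parts_sum
  simp only at h
  rw [h, h2] at h1
  have h3 : n = m := Fin.ext h1
  subst h3
  congr
  exact Nat.Partition.ext h

lemma PBP_exists {w : ℕ} (m : Multiset ℕ) (h0 : ∀ x ∈ m, x ≠ 0) (hs : m.sum ≤ w) :
    ∃ a : PBP w, a.2.parts = m :=
  ⟨⟨⟨m.sum, by omega⟩, ⟨m, fun hx => Nat.pos_of_ne_zero (h0 _ hx), rfl⟩⟩, rfl⟩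

lemma PBP_ne {w : ℕ} (a : PBP w) : ∀ x ∈ a.2.parts, x ≠ 0 :=
  fun _ hx => (a.2.parts_pos hx).ne'

lemma PBP_sum {w : ℕ} (a : PBP w) : a.2.parts.sum = (a.1 : ℕ) := a.2.parts_sum

lemma sval_eq {w : ℕ} (lam : PBP w) (nu : Multiset ℕ) :
    sval lam.2.parts nu
      = ∑ kap : PBP w, (Kc lam.2.parts kap.2.parts : ℚ) * (Mcount kap.2.parts nu : ℚ) := by
  rw [sval_def]
  unfold Kc
  push_cast
  simp_rw [Finset.sum_mul]
  rw [Finset.sum_comm]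
  apply Finset.sum_congr rfl
  intro σ _
  simp_rw [mul_assoc]
  rw [← Finset.mul_sum]
  congr 1
  by_cases h : jtcOk lam.2.parts σ
  · rw [if_pos h]
    obtain ⟨a, ha⟩ := PBP_exists (w := w) (jtc lam.2.parts σ)
      (fun x hx => (Multiset.mem_filter.1 hx).2)
      (by rw [jtc_sum _ _ h, PBP_sum]; omega)
    rw [Finset.sum_eq_single a]
    · rw [if_pos ⟨h, ha.symm⟩, ha, one_mul]
    · intro b _ hb
      rw [if_neg, zero_mul]
      rintro ⟨_, h2⟩
      exact hb (PBP_ext (h2.symm.trans ha.symm))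
    · simp
  · simp [h]

lemma sval_eq_zero {n : ℕ} (lam : Nat.Partition n) (nu : Multiset ℕ) (h : nu.sum ≠ n) :
    sval lam.parts nu = 0 := by
  rw [sval_def]
  apply Finset.sum_eq_zero
  intro σ _
  split_ifs with h1
  · rw [Mcount_eq_zero]
    · simp
    · rw [jtc_sum _ _ h1, lam.parts_sum]; exact h
  · simp

/-! ### The series `exp (∑ c_k z^k / k)` -/

section HSeries

set_option linter.unusedSectionVars false

variable {R : Type*} [CommRing R] [Algebra ℚ R]

/-- the term `c_m / z_m`. -/
def eH (c : ℕ → R) (m : Multiset ℕ) : R := ((zMult m : ℚ)⁻¹) • (m.map c).prod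

/-- all multisets of parts of partitions of `n`. -/
def pset (n : ℕ) : Finset (Multiset ℕ) :=
  (Finset.univ : Finset (Nat.Partition n)).image Nat.Partition.parts

lemma mem_pset {n : ℕ} {m : Multiset ℕ} : m ∈ pset n ↔ m.sum = n ∧ ∀ x ∈ m, x ≠ 0 := by
  unfold pset
  simp only [Finset.mem_image, Finset.mem_univ, true_and]
  constructor
  · rintro ⟨a, rfl⟩
    exact ⟨a.parts_sum, fun x hx => (a.parts_pos hx).ne'⟩
  · rintro ⟨h1, h2⟩
    exact ⟨⟨m, fun hx => Nat.pos_of_ne_zero (h2 _ hx), h1⟩, rfl⟩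

lemma sum_pset {n : ℕ} (f : Multiset ℕ → R) :
    ∑ m ∈ pset n, f m = ∑ a : Nat.Partition n, f a.parts := by
  unfold pset
  rw [Finset.sum_image]
  intro a _ b _ h
  exact Nat.Partition.ext h

/-- The series `exp (∑ c_k z^k / k)`. -/
def HS (c : ℕ → R) : PowerSeries R := PowerSeries.mk fun n => ∑ m ∈ pset n, eH c m

lemma zMult_eq_prod (m : Multiset ℕ) (S : Finset ℕ) (h : m.toFinset ⊆ S) :
    zMult m = ∏ i ∈ S, i ^ m.count i * (m.count i).factorial := by
  unfold zMult
  apply Finset.prod_subset h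
  intro x _ hx
  have : m.count x = 0 := by simpa using hx
  simp [this]

lemma zMult_cons (k : ℕ) (m : Multiset ℕ) :
    zMult (k ::ₘ m) = k * (m.count k + 1) * zMult m := by
  rw [zMult_eq_prod (k ::ₘ m) (insert k m.toFinset) (by simp),
    zMult_eq_prod m (insert k m.toFinset) (by simp)]
  rw [← Finset.mul_prod_erase _ _ (Finset.mem_insert_self k _),
    ← Finset.mul_prod_erase (insert k m.toFinset) (fun i => i ^ m.count i * (m.count i).factorial)
      (Finset.mem_insert_self k _)]
  have : ∏ x ∈ (insert k m.toFinset).erase k,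
      x ^ (k ::ₘ m).count x * ((k ::ₘ m).count x).factorial
      = ∏ x ∈ (insert k m.toFinset).erase k, x ^ m.count x * (m.count x).factorial := by
    apply Finset.prod_congr rfl
    intro x hx
    rw [Multiset.count_cons_of_ne (Finset.mem_erase.1 hx).1]
  rw [this, Multiset.count_cons_self, pow_succ, Nat.factorial_succ]
  ring

lemma zMult_ne {m : Multiset ℕ} (h : ∀ x ∈ m, x ≠ 0) : (zMult m : ℚ) ≠ 0 := by
  unfold zMult
  rw [Nat.cast_ne_zero, Finset.prod_ne_zero_iff]
  intro i hi
  have := h i (by simpa using hi)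
  positivity

lemma eH_cons (c : ℕ → R) (k : ℕ) (m : Multiset ℕ) (hk : k ≠ 0) :
    ((k * ((k ::ₘ m).count k) : ℕ) : R) * eH c (k ::ₘ m) = c k * eH c m := by
  unfold eH
  rw [zMult_cons, Multiset.map_cons, Multiset.prod_cons, Multiset.count_cons_self]
  rw [← map_natCast (algebraMap ℚ R), ← Algebra.smul_def, smul_smul, mul_smul_comm]
  congr 1
  push_cast
  have h1 : (k : ℚ) ≠ 0 := by exact_mod_cast hk
  have h2 : ((m.count k : ℚ) + 1) ≠ 0 := by positivity
  rw [mul_inv, ← mul_assoc, mul_inv_cancel₀ (mul_ne_zero h1 h2), one_mul]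

lemma HS_newton (c : ℕ → R) (n : ℕ) :
    (n : R) * PowerSeries.coeff n (HS c)
      = ∑ p ∈ Finset.HasAntidiagonal.antidiagonal n,
        (if p.1 = 0 then 0 else c p.1) * PowerSeries.coeff p.2 (HS c) := by
  simp only [HS, PowerSeries.coeff_mk]
  have h1 : (n : R) * ∑ m ∈ pset n, eH c m
      = ∑ m ∈ pset n, ∑ k ∈ m.toFinset, c k * eH c (m.erase k) := by
    rw [Finset.mul_sum]
    apply Finset.sum_congr rfl
    intro m hm
    rw [mem_pset] at hm
    rw [← hm.1, Finset.sum_multiset_count, Nat.cast_sum, Finset.sum_mul]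
    apply Finset.sum_congr rfl
    intro k hk
    have hk' : k ∈ m := by simpa using hk
    have := eH_cons c k (m.erase k) (hm.2 k hk')
    rw [Multiset.cons_erase hk'] at this
    rw [← this, smul_eq_mul, mul_comm (m.count k)]
  rw [h1]
  have h2 : ∑ p ∈ Finset.HasAntidiagonal.antidiagonal n,
        (if p.1 = 0 then 0 else c p.1) * ∑ m ∈ pset p.2, eH c m
      = ∑ p ∈ (Finset.HasAntidiagonal.antidiagonal n).filter (fun p => p.1 ≠ 0),
        ∑ m ∈ pset p.2, c p.1 * eH c m := by
    rw [Finset.sum_filter]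
    apply Finset.sum_congr rfl
    intro p _
    by_cases hp : p.1 = 0
    · simp [hp]
    · simp [hp, Finset.mul_sum]
  rw [h2, Finset.sum_sigma', Finset.sum_sigma']
  refine Finset.sum_bij' (fun x _ => ⟨(x.2, n - x.2), x.1.erase x.2⟩)
    (fun y _ => ⟨y.1.1 ::ₘ y.2, y.1.1⟩) ?_ ?_ ?_ ?_ ?_
  · rintro ⟨m, k⟩ h
    simp only [Finset.mem_sigma, mem_pset, Multiset.mem_toFinset] at h
    obtain ⟨⟨hs, hp⟩, hk⟩ := h
    have h3 : k + (m.erase k).sum = n := by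
      rw [← Multiset.sum_cons, Multiset.cons_erase hk, hs]
    simp only [Finset.mem_sigma, mem_pset, Finset.mem_filter, Finset.HasAntidiagonal.mem_antidiagonal]
    refine ⟨⟨by omega, hp k hk⟩, by omega, fun x hx => hp x (Multiset.mem_of_mem_erase hx)⟩
  · rintro ⟨⟨i, j⟩, m⟩ h
    simp only [Finset.mem_sigma, mem_pset, Finset.mem_filter, Finset.HasAntidiagonal.mem_antidiagonal] at h
    obtain ⟨⟨hs, hp⟩, hk, hm⟩ := h
    simp only [Finset.mem_sigma, mem_pset, Multiset.mem_toFinset, Multiset.sum_cons,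
      Multiset.mem_cons, true_or, and_true]
    refine ⟨by omega, ?_⟩
    rintro x (rfl | hx)
    · exact hp
    · exact hm x hx
  · rintro ⟨m, k⟩ h
    simp only [Finset.mem_sigma, mem_pset, Multiset.mem_toFinset] at h
    simp [Multiset.cons_erase h.2]
  · rintro ⟨⟨i, j⟩, m⟩ h
    simp only [Finset.mem_sigma, mem_pset, Finset.mem_filter, Finset.HasAntidiagonal.mem_antidiagonal] at h
    have : n - i = j := by omega
    simp [this]
  · rintro ⟨m, k⟩ h
    rfl

lemma HS_zero_coeff (c : ℕ → R) : PowerSeries.coeff 0 (HS c) = 1 := by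
  have : pset 0 = {0} := by
    ext m
    rw [mem_pset]
    simp only [Finset.mem_singleton]
    constructor
    · rintro ⟨h1, h2⟩
      rw [Multiset.eq_zero_iff_forall_notMem]
      intro a ha
      exact h2 a ha (Multiset.sum_eq_zero_iff.1 h1 a ha)
    · rintro rfl; simp
  simp [HS, this, eH, zMult]

/-- the series `∑ c_k z^k`. -/
def PS (c : ℕ → R) : PowerSeries R := PowerSeries.mk fun n => if n = 0 then 0 else c n

lemma HS_ode (c : ℕ → R) :
    PowerSeries.X * PowerSeries.derivative R (HS c) = PS c * HS c := by
  ext n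
  rw [PowerSeries.coeff_mul n (PS c)]
  simp only [PS, PowerSeries.coeff_mk]
  rw [← HS_newton]
  cases n with
  | zero => simp
  | succ n =>
    rw [PowerSeries.coeff_succ_X_mul, PowerSeries.coeff_derivative]
    push_cast
    ring

lemma ode_unique (P f g : PowerSeries R) (hP : PowerSeries.coeff 0 P = 0)
    (hf : PowerSeries.X * PowerSeries.derivative R f = P * f)
    (hg : PowerSeries.X * PowerSeries.derivative R g = P * g)
    (h0 : PowerSeries.coeff 0 f = PowerSeries.coeff 0 g) : f = g := by
  ext n
  induction n using Nat.strong_induction_on with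
  | _ n ih =>
    cases n with
    | zero => exact h0
    | succ n =>
      have h1 := congrArg (PowerSeries.coeff (n + 1)) hf
      have h2 := congrArg (PowerSeries.coeff (n + 1)) hg
      rw [PowerSeries.coeff_succ_X_mul, PowerSeries.coeff_derivative, PowerSeries.coeff_mul] at h1 h2
      have h3 : ∑ p ∈ Finset.HasAntidiagonal.antidiagonal (n + 1), PowerSeries.coeff p.1 P * PowerSeries.coeff p.2 f
          = ∑ p ∈ Finset.HasAntidiagonal.antidiagonal (n + 1), PowerSeries.coeff p.1 P * PowerSeries.coeff p.2 g := by
        apply Finset.sum_congr rfl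
        rintro ⟨i, j⟩ hp
        rw [Finset.HasAntidiagonal.mem_antidiagonal] at hp
        simp only at hp ⊢
        by_cases hi : i = 0
        · subst hi; rw [hP, zero_mul, zero_mul]
        · rw [ih j (by omega)]
      rw [h3, ← h2] at h1
      have hu : IsUnit ((n : R) + 1) := by
        have : ((n : R) + 1) = algebraMap ℚ R ((n : ℚ) + 1) := by simp
        rw [this]
        apply IsUnit.map
        rw [isUnit_iff_ne_zero]
        positivity
      exact hu.mul_right_cancel h1

lemma PS_add (c d : ℕ → R) : PS (c + d) = PS c + PS d := by
  ext n
  by_cases h : n = 0 <;> simp [PS, h]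

lemma HS_add (c d : ℕ → R) : HS (c + d) = HS c * HS d := by
  apply ode_unique (PS (c + d))
  · simp [PS]
  · exact HS_ode _
  · rw [Derivation.leibniz, PS_add, smul_eq_mul, smul_eq_mul, mul_add]
    have h1 := HS_ode c
    have h2 := HS_ode d
    calc _ = HS c * (PowerSeries.X * PowerSeries.derivative R (HS d))
          + HS d * (PowerSeries.X * PowerSeries.derivative R (HS c)) := by ring
      _ = _ := by rw [h1, h2]; ring
  · rw [HS_zero_coeff]
    simp only [PowerSeries.coeff_zero_eq_constantCoeff, map_mul]
    simp only [← PowerSeries.coeff_zero_eq_constantCoeff, HS_zero_coeff]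
    simp

lemma HS_zero : HS (0 : ℕ → R) = 1 := by
  apply ode_unique 0
  · simp
  · rw [HS_ode]
    have : PS (0 : ℕ → R) = 0 := by ext n; simp [PS]
    rw [this]
  · simp
  · rw [HS_zero_coeff]; simp

/-- `HS` as a homomorphism. -/
def HSHom : Multiplicative (ℕ → R) →* (PowerSeries R)ˣ :=
  MonoidHom.toHomUnits
    { toFun := fun c => HS (Multiplicative.toAdd c)
      map_one' := HS_zero
      map_mul' := fun _ _ => HS_add _ _ }

lemma HSHom_coe (c : ℕ → R) : ((HSHom (Multiplicative.ofAdd c) : (PowerSeries R)ˣ) : PowerSeries R)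
    = HS c := rfl

lemma HS_sum {ι : Type*} (s : Finset ι) (c : ι → ℕ → R) :
    HS (∑ i ∈ s, c i) = ∏ i ∈ s, HS (c i) := by
  rw [← HSHom_coe, ofAdd_sum, map_prod, Units.coe_prod]
  rfl

lemma prod_map_pow_sum' (x : R) (m : Multiset ℕ) :
    (m.map (fun k => x ^ k)).prod = x ^ m.sum := by
  induction m using Multiset.induction_on with
  | empty => simp
  | cons a s ih => simp [ih, pow_add]

lemma HS_scale (c : ℕ → R) (x : R) :
    HS (fun k => x ^ k * c k) = PowerSeries.rescale x (HS c) := by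
  ext n
  rw [PowerSeries.coeff_rescale]
  simp only [HS, PowerSeries.coeff_mk]
  rw [Finset.mul_sum]
  apply Finset.sum_congr rfl
  intro m hm
  rw [mem_pset] at hm
  unfold eH
  rw [mul_smul_comm, Multiset.prod_map_mul, ← hm.1, prod_map_pow_sum']

end HSeries

/-! ### Generating functions for `Mcount` -/

section Gen

set_option linter.unusedSectionVars false

/-- power sums -/
def pw (R : Type*) [CommRing R] (l k : ℕ) : MvPolynomial (Fin l) R :=
  ∑ i : Fin l, MvPolynomial.X i ^ k

/-- exponent vector of a multiset -/
def exv (lam : Multiset ℕ) : Fin (Multiset.card lam) →₀ ℕ :=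
  Finsupp.equivFunOnFinite.symm (fun i => (lam.sort (· ≤ ·)).getD i 0)

lemma prod_map_sort {R : Type*} [CommMonoid R] (m : Multiset ℕ) (f : ℕ → R) :
    (m.map f).prod = ∏ j : Fin (Multiset.card m), f ((m.sort (· ≤ ·)).getD j 0) := by
  conv_lhs => rw [← univ_map_sort m]
  rw [Multiset.map_map]
  rfl

lemma coeff_pw {R : Type*} [CommRing R] (lam m : Multiset ℕ) :
    MvPolynomial.coeff (exv lam) (m.map (pw R (Multiset.card lam))).prod = (Mcount lam m : R) := by
  rw [prod_map_sort]
  unfold pw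
  rw [Fintype.prod_sum, MvPolynomial.coeff_sum]
  have h1 : ∀ f : Fin (Multiset.card m) → Fin (Multiset.card lam),
      MvPolynomial.coeff (exv lam)
        (∏ j, (MvPolynomial.X (f j) : MvPolynomial _ R) ^ (m.sort (· ≤ ·)).getD j 0)
      = if (∀ i : Fin (Multiset.card lam),
      (∑ j ∈ Finset.univ.filter (fun j => f j = i), (m.sort (· ≤ ·)).getD j 0)
        = (lam.sort (· ≤ ·)).getD i 0) then 1 else 0 := by
    intro f
    have h2 : (∏ j, (MvPolynomial.X (f j) : MvPolynomial _ R) ^ (m.sort (· ≤ ·)).getD j 0)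
        = MvPolynomial.monomial (∑ j, Finsupp.single (f j) ((m.sort (· ≤ ·)).getD j 0)) 1 := by
      rw [MvPolynomial.monomial_sum_one]
      apply Finset.prod_congr rfl
      intro j _
      rw [MvPolynomial.X_pow_eq_monomial]
    rw [h2, MvPolynomial.coeff_monomial]
    congr 1
    rw [eq_iff_iff, Finsupp.ext_iff]
    apply forall_congr'
    intro i
    rw [Finsupp.finsetSum_apply]
    simp [exv, Finsupp.single_apply, Finset.sum_filter]
  simp_rw [h1]
  unfold Mcount
  rw [Finset.sum_boole, Fintype.card_subtype]

variable {R : Type*} [CommRing R] [Algebra ℚ R]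

lemma eH_map {S : Type*} [CommRing S] [Algebra ℚ S] (φ : R →+* S) (c : ℕ → R) (m : Multiset ℕ) :
    φ (eH c m) = eH (fun k => φ (c k)) m := by
  unfold eH
  rw [map_rat_smul, map_multiset_prod, Multiset.map_map]
  rfl

lemma HS_map {S : Type*} [CommRing S] [Algebra ℚ S] (φ : R →+* S) (c : ℕ → R) :
    HS (fun k => φ (c k)) = PowerSeries.map φ (HS c) := by
  ext n
  simp [HS, eH_map]

lemma eH_mul (c d : ℕ → R) (m : Multiset ℕ) :
    eH (fun k => c k * d k) m = eH c m * (m.map d).prod := by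
  unfold eH
  rw [Multiset.prod_map_mul, smul_mul_assoc]

lemma coeff_prod_congr {ι : Type*} (s : Finset ι) (f g : ι → PowerSeries R) (w : ℕ)
    (h : ∀ i ∈ s, ∀ m ≤ w, PowerSeries.coeff m (f i) = PowerSeries.coeff m (g i)) :
    ∀ n ≤ w, PowerSeries.coeff n (∏ i ∈ s, f i) = PowerSeries.coeff n (∏ i ∈ s, g i) := by
  induction s using Finset.induction_on with
  | empty => intro n _; simp
  | insert a s ha ih =>
    intro n hn
    rw [Finset.prod_insert ha, Finset.prod_insert ha, PowerSeries.coeff_mul, PowerSeries.coeff_mul]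
    apply Finset.sum_congr rfl
    rintro ⟨i, j⟩ hp
    rw [Finset.HasAntidiagonal.mem_antidiagonal] at hp
    simp only at hp ⊢
    rw [h a (Finset.mem_insert_self a s) i (by omega),
      ih (fun i hi => h i (Finset.mem_insert_of_mem hi)) j (by omega)]

lemma coeff_prod_HS {Q : Type*} [Fintype Q] (d : Q → ℕ → R) (w n : ℕ) (hn : n ≤ w) :
    PowerSeries.coeff n (∏ q, HS (d q))
      = ∑ nu : Q → PBP w, if ∑ q, ((nu q).1 : ℕ) = n then ∏ q, eH (d q) (nu q).2.parts else 0 := by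
  rw [coeff_prod_congr Finset.univ (fun q => HS (d q))
    (fun q => ∑ a : PBP w, PowerSeries.C (eH (d q) a.2.parts) * PowerSeries.X ^ (a.1 : ℕ)) w ?_ n hn]
  · rw [Fintype.prod_sum, map_sum]
    apply Finset.sum_congr rfl
    intro nu _
    rw [Finset.prod_mul_distrib, ← map_prod, Finset.prod_pow_eq_pow_sum, PowerSeries.coeff_C_mul,
      PowerSeries.coeff_X_pow]
    simp [eq_comm]
  · intro q _ m hm
    rw [map_sum, Fintype.sum_sigma]
    simp only [PowerSeries.coeff_C_mul, PowerSeries.coeff_X_pow]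
    rw [Finset.sum_eq_single (⟨m, by omega⟩ : Fin (w + 1))]
    · simp [HS, sum_pset]
    · intro b _ hb
      apply Finset.sum_eq_zero
      intro a _
      rw [if_neg, mul_zero]
      intro h
      apply hb
      exact Fin.ext h.symm
    · simp

lemma prod_map_sum {Q : Type*} (s : Finset Q) (m : Q → Multiset ℕ) (f : ℕ → R) :
    ((∑ q ∈ s, m q).map f).prod = ∏ q ∈ s, ((m q).map f).prod := by
  induction s using Finset.induction_on with
  | empty => simp
  | insert a s ha ih => rw [Finset.sum_insert ha, Finset.prod_insert ha]; simp [ih]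

lemma parts_sum_sum {Q : Type*} [Fintype Q] {w : ℕ} (nu : Q → PBP w) :
    (∑ q, (nu q).2.parts).sum = ∑ q, ((nu q).1 : ℕ) := by
  have h3 := map_sum (Multiset.sumAddMonoidHom : Multiset ℕ →+ ℕ)
      (fun i => (nu i).2.parts) Finset.univ
  simp only [Multiset.coe_sumAddMonoidHom, Nat.Partition.parts_sum] at h3
  exact h3

lemma key_sum {Q : Type*} [Fintype Q] (c : Q → ℕ → R) (w : ℕ) (lam : Multiset ℕ)
    (hl : lam.sum ≤ w) :
    ∑ nu : Q → PBP w, (Mcount lam (∑ q, (nu q).2.parts) : R) * ∏ q, eH (c q) (nu q).2.parts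
      = (lam.map (fun k => PowerSeries.coeff k (HS (∑ q, c q)))).prod := by
  let d : Q → ℕ → MvPolynomial (Fin (Multiset.card lam)) R :=
    fun q k => MvPolynomial.C (c q k) * pw R (Multiset.card lam) k
  have hA := congrArg (MvPolynomial.coeff (exv lam)) (coeff_prod_HS d w lam.sum hl)
  have hsum : ∑ i, exv lam i = lam.sum := by
    have := sum_sort lam (fun x => x)
    rw [Multiset.map_id'] at this
    rw [← this]; rfl
  have hR : MvPolynomial.coeff (exv lam) (∑ nu : Q → PBP w,
      if ∑ q, ((nu q).1 : ℕ) = lam.sum then ∏ q, eH (d q) (nu q).2.parts else 0)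
      = ∑ nu : Q → PBP w, (Mcount lam (∑ q, (nu q).2.parts) : R)
        * ∏ q, eH (c q) (nu q).2.parts := by
    rw [MvPolynomial.coeff_sum]
    apply Finset.sum_congr rfl
    intro nu _
    split_ifs with h
    · have h1 : ∏ q, eH (d q) (nu q).2.parts
          = MvPolynomial.C (∏ q, eH (c q) (nu q).2.parts)
            * ((∑ q, (nu q).2.parts).map (pw R (Multiset.card lam))).prod := by
        rw [prod_map_sum, map_prod, ← Finset.prod_mul_distrib]
        apply Finset.prod_congr rfl
        intro q _
        rw [eH_mul, eH_map]
      rw [h1, MvPolynomial.coeff_C_mul, coeff_pw, mul_comm]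
    · rw [Mcount_eq_zero]
      · simp
      · rw [parts_sum_sum]; exact h
  have hL : MvPolynomial.coeff (exv lam) (PowerSeries.coeff lam.sum (∏ q, HS (d q)))
      = (lam.map (fun k => PowerSeries.coeff k (HS (∑ q, c q)))).prod := by
    rw [← HS_sum]
    have h1 : ∑ q, d q = ∑ i : Fin (Multiset.card lam), (fun k => (MvPolynomial.X i) ^ k *
        MvPolynomial.C ((∑ q, c q) k)) := by
      funext k
      simp only [d, Finset.sum_apply, pw]
      rw [← Finset.sum_mul, map_sum, Finset.mul_sum]
      apply Finset.sum_congr rfl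
      intro i _
      rw [mul_comm]
    rw [h1, HS_sum]
    simp_rw [HS_scale, HS_map]
    rw [PowerSeries.coeff_prod, MvPolynomial.coeff_sum]
    have h2 : ∀ l : Fin (Multiset.card lam) →₀ ℕ, ∏ i, PowerSeries.coeff (l i)
        (PowerSeries.rescale (MvPolynomial.X i)
          (PowerSeries.map (MvPolynomial.C (σ := Fin (Multiset.card lam))) (HS (∑ q, c q))))
        = MvPolynomial.monomial l (∏ i, PowerSeries.coeff (l i) (HS (∑ q, c q))) := by
      intro l
      simp only [PowerSeries.coeff_rescale, PowerSeries.coeff_map]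
      rw [Finset.prod_mul_distrib, ← map_prod, MvPolynomial.monomial_eq, mul_comm]
      congr 1
      rw [Finsupp.prod_fintype]
      simp
    simp_rw [h2, MvPolynomial.coeff_monomial]
    rw [Finset.sum_ite_eq', if_pos, prod_map_sort]
    · rfl
    · rw [Finset.mem_finsuppAntidiag]
      exact ⟨hsum, by simp⟩
  rw [← hR, ← hA, hL]

/-- the inclusion of a block of variables -/
def sgm {Q : Type*} (n : Q → ℕ) (q : Q) (i : Fin (n q)) : (Σ q, Fin (n q)) := ⟨q, i⟩

lemma sgm_inj {Q : Type*} (n : Q → ℕ) (q : Q) : Function.Injective (sgm n q) :=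
  fun i j h => by
    unfold sgm at h
    simpa using h

lemma coeff_prod_rename {Q : Type*} [Fintype Q] {n : Q → ℕ} (f : ∀ q, MvPolynomial (Fin (n q)) R)
    (a : ∀ q, Fin (n q) →₀ ℕ) :
    MvPolynomial.coeff (Finsupp.equivFunOnFinite.symm (fun x : (Σ q, Fin (n q)) => a x.1 x.2))
      (∏ q, MvPolynomial.rename (sgm n q) (f q))
      = ∏ q, MvPolynomial.coeff (a q) (f q) := by
  have h1 : ∀ q, MvPolynomial.rename (sgm n q) (f q)
      = ∑ m ∈ (f q).support, MvPolynomial.monomial (Finsupp.mapDomain (sgm n q) m)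
        (MvPolynomial.coeff m (f q)) := by
    intro q
    conv_lhs => rw [(f q).as_sum]
    rw [map_sum]
    simp_rw [MvPolynomial.rename_monomial]
  simp_rw [h1]
  rw [Finset.prod_univ_sum, MvPolynomial.coeff_sum]
  have h2 : ∀ m : (∀ q, Fin (n q) →₀ ℕ), ∏ q, MvPolynomial.monomial
      (Finsupp.mapDomain (sgm n q) (m q))
      (MvPolynomial.coeff (m q) (f q))
      = MvPolynomial.monomial (Finsupp.equivFunOnFinite.symm
        (fun x : (Σ q, Fin (n q)) => m x.1 x.2)) (∏ q, MvPolynomial.coeff (m q) (f q)) := by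
    intro m
    rw [← MvPolynomial.monomial_sum_prod]
    refine congrArg (fun e => MvPolynomial.monomial e _) ?_
    ext ⟨q, i⟩
    rw [Finsupp.finsetSum_apply, Finset.sum_eq_single q]
    · exact Finsupp.mapDomain_apply (sgm_inj n q) (m q) i
    · intro r _ hr
      apply Finsupp.mapDomain_of_notMem_range
      rintro ⟨j, hj⟩
      exact hr (congrArg Sigma.fst hj)
    · simp
  simp_rw [h2, MvPolynomial.coeff_monomial]
  have h3 : ∀ m : (∀ q, Fin (n q) →₀ ℕ), (Finsupp.equivFunOnFinite.symm
        (fun x : (Σ q, Fin (n q)) => m x.1 x.2) = Finsupp.equivFunOnFinite.symm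
        (fun x : (Σ q, Fin (n q)) => a x.1 x.2)) ↔ m = a := by
    intro m
    rw [Equiv.apply_eq_iff_eq]
    constructor
    · intro h
      funext q
      ext i
      exact congrFun h ⟨q, i⟩
    · rintro rfl; rfl
  simp_rw [h3]
  rw [Finset.sum_ite_eq']
  split_ifs with h
  · rfl
  · rw [Fintype.mem_piFinset] at h
    push Not at h
    obtain ⟨q, hq⟩ := h
    rw [MvPolynomial.notMem_support_iff] at hq
    exact (Finset.prod_eq_zero (Finset.mem_univ q) hq).symm

end Gen

/-! ### Reduction of the entries to finite sums -/

section Red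

variable {T Q : Type*} [Fintype T] [Fintype Q]

/-- The entry with the class functions replaced by an arbitrary function `f`. -/
def wg (f : Multiset ℕ → Multiset ℕ → ℚ) {w : ℕ} (A : T → Q → ℚ) (lam : T → PBP w)
    (mu : Q → PBP w) : ℚ :=
  ∑ nu : T × Q → PBP w,
    (∏ t, f (lam t).2.parts (∑ q, (nu (t, q)).2.parts)) *
    (∏ q, f (mu q).2.parts (∑ t, (nu (t, q)).2.parts)) *
    ∏ t, ∏ q, (A t q ^ (Multiset.card (nu (t, q)).2.parts) * (zMult (nu (t, q)).2.parts : ℚ)⁻¹)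

/-- inclusion -/
def pinc {w : ℕ} (p : PBP w) : PttAll := ⟨p.1, p.2⟩

lemma pinc_inj {w : ℕ} : Function.Injective (pinc (w := w)) := by
  intro a b h
  apply PBP_ext
  exact congrArg (fun x : PttAll => x.2.parts) h

lemma pair_pt {η : Type*} [Fintype η] {a : ℕ} (lam : Nat.Partition a) (nu : η → PttAll) :
    pairCF (sFun lam) (multiProdCF (fun i => (nu i).1) rfl (fun i => ptFun (nu i).2))
      = sval lam.parts (∑ i, (nu i).2.parts) * ∏ i, (zMult (nu i).2.parts : ℚ)⁻¹ := by
  have := pairCF_gen (fun i => (nu i).1) (a := a) (sval lam.parts)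
    (fun m hm => sval_eq_zero lam m hm) (fun i => (nu i).2) (fun _ => 1)
  simp only [one_div] at this
  exact this

lemma pair_p {η : Type*} [Fintype η] {a : ℕ} (lam : Nat.Partition a) (nu : η → PttAll) :
    pairCF (sFun lam) (multiProdCF (fun i => (nu i).1) rfl (fun i => pFun (nu i).2))
      = sval lam.parts (∑ i, (nu i).2.parts) := by
  have := pairCF_gen (fun i => (nu i).1) (a := a) (sval lam.parts)
    (fun m hm => sval_eq_zero lam m hm) (fun i => (nu i).2)
    (fun i => (zMult (nu i).2.parts : ℚ))
  rw [Finset.prod_eq_one, mul_one] at this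
  · exact this
  · intro i _
    apply div_self
    exact zMult_ne (fun x hx => ((nu i).2.parts_pos hx).ne')

lemma wrSMat_eq {w : ℕ} (A : T → Q → ℚ) (lam : PMapw T w) (mu : PMapw Q w) :
    wrSMat A w lam mu = wg sval A lam.1 mu.1 := by
  unfold wrSMat wrS wrGen
  rw [Matrix.of_apply]
  simp only [pair_pt, pair_p]
  have hinj : Function.Injective (fun (nu : T × Q → PBP w) x => pinc (nu x)) := by
    intro a b h
    funext x
    exact pinc_inj (congrFun h x)
  rw [finsum_eq_sum_of_support_subset (s := Finset.univ.image
    (fun (nu : T × Q → PBP w) x => pinc (nu x)))]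
  · rw [Finset.sum_image (fun a _ b _ h => hinj h)]
    unfold wg
    apply Finset.sum_congr rfl
    intro nu _
    simp only [pinc, Finset.prod_mul_distrib]
    ring
  · intro nu hnu
    rw [Function.mem_support] at hnu
    have h1 := left_ne_zero_of_mul (left_ne_zero_of_mul hnu)
    rw [Finset.prod_ne_zero_iff] at h1
    have h2 : ∀ x, (nu x).1 < w + 1 := by
      rintro ⟨t, q⟩
      have h3 := left_ne_zero_of_mul (h1 t (Finset.mem_univ t))
      have h4 : (∑ q, (nu (t, q)).2.parts).sum = ((lam.1 t).1 : ℕ) := by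
        by_contra hc
        exact h3 (sval_eq_zero (lam.1 t).2 _ hc)
      have h5 : (∑ q, (nu (t, q)).2.parts).sum = ∑ q, (nu (t, q)).1 := by
        have : ∀ s : Finset Q, (∑ q ∈ s, (nu (t, q)).2.parts).sum = ∑ q ∈ s, (nu (t, q)).1 := by
          intro s
          induction s using Finset.induction_on with
          | empty => simp
          | insert a s ha ih =>
            rw [Finset.sum_insert ha, Finset.sum_insert ha, Multiset.sum_add, ih,
              (nu (t, a)).2.parts_sum]
        exact this _
      have h6 : (nu (t, q)).1 ≤ ∑ q, (nu (t, q)).1 :=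
        Finset.single_le_sum (f := fun q => (nu (t, q)).1) (fun _ _ => Nat.zero_le _)
          (Finset.mem_univ q)
      have := (lam.1 t).1.2
      omega
    rw [Finset.coe_image]
    refine ⟨fun x => ⟨⟨(nu x).1, h2 x⟩, (nu x).2⟩, by simp, ?_⟩
    funext x
    rfl

/-- the integer transition matrix -/
def KM (T : Type*) [Fintype T] (w : ℕ) : Matrix (PMapw T w) (PMapw T w) ℤ :=
  Matrix.of fun lam kap => ∏ t, Kc (lam.1 t).2.parts (kap.1 t).2.parts

/-- the matrix with permutation characters -/
def EM (A : T → Q → ℚ) (w : ℕ) : Matrix (PMapw T w) (PMapw Q w) ℚ :=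
  Matrix.of fun lam mu => wg (fun a b => (Mcount a b : ℚ)) A lam.1 mu.1

lemma sum_PMapw {M : Type*} [AddCommMonoid M] {w : ℕ} (F : (T → PBP w) → M)
    (h : ∀ k, F k ≠ 0 → ∑ t, ((k t).1 : ℕ) = w) :
    ∑ k : PMapw T w, F k.1 = ∑ k, F k := by
  apply Fintype.sum_of_injective (fun k : PMapw T w => k.1) Subtype.val_injective
  · intro k hk
    by_contra hc
    exact hk ⟨⟨k, h k hc⟩, rfl⟩
  · intro k
    rfl

lemma prod_Kc_ne {w : ℕ} (lam kap : T → PBP w)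
    (h : ∏ t, Kc (lam t).2.parts (kap t).2.parts ≠ 0) (t : T) :
    ((kap t).1 : ℕ) = (lam t).1 ∧ (lam t = kap t ∨ sqs (lam t).2.parts < sqs (kap t).2.parts) := by
  rw [Finset.prod_ne_zero_iff] at h
  have := Kc_ne _ _ (PBP_ne _) (h t (Finset.mem_univ t))
  rw [PBP_sum, PBP_sum] at this
  exact ⟨this.1, this.2.imp PBP_ext id⟩

lemma prod_sval {w : ℕ} (lam : PMapw T w) (m : T → Multiset ℕ) :
    ∏ t, sval (lam.1 t).2.parts (m t)
      = ∑ kap : PMapw T w, (KM T w lam kap : ℚ) * ∏ t, (Mcount (kap.1 t).2.parts (m t) : ℚ) := by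
  simp only [sval_eq, KM, Matrix.of_apply]
  rw [Fintype.prod_sum]
  simp only [Finset.prod_mul_distrib]
  symm
  have := sum_PMapw (T := T) (w := w)
    (fun kap => ((∏ t, Kc (lam.1 t).2.parts (kap t).2.parts : ℤ) : ℚ) *
      ∏ t, (Mcount (kap t).2.parts (m t) : ℚ)) ?_
  · rw [this]
    push_cast
    rfl
  · intro k hk
    have h1 := left_ne_zero_of_mul hk
    rw [Int.cast_ne_zero] at h1
    exact (Finset.sum_congr rfl (fun t _ => (prod_Kc_ne _ _ h1 t).1)).trans lam.2

lemma KM_unit (T : Type*) [Fintype T] (w : ℕ) : IsUnit (KM T w) := by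
  rw [Matrix.isUnit_iff_isUnit_det]
  let b : PMapw T w → ℕ := fun k => ∑ t, sqs (k.1 t).2.parts
  have hle : ∀ i j, KM T w i j ≠ 0 → ∀ t, sqs (i.1 t).2.parts ≤ sqs (j.1 t).2.parts := by
    intro i j h t
    rcases (prod_Kc_ne i.1 j.1 h t).2 with h | h
    · rw [h]
    · exact h.le
  have hb : Matrix.BlockTriangular (KM T w) b := by
    intro i j hij
    by_contra hc
    exact absurd (Finset.sum_le_sum (fun t _ => hle i j hc t)) (not_le.2 hij)
  rw [hb.det]
  rw [Finset.prod_eq_one]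
  · exact isUnit_one
  · intro a _
    have : Matrix.toSquareBlock (KM T w) b a = 1 := by
      ext ⟨i, hi⟩ ⟨j, hj⟩
      rw [Matrix.toSquareBlock_def, Matrix.of_apply]
      by_cases hij : i = j
      · subst hij
        rw [Matrix.one_apply_eq]
        exact Finset.prod_eq_one (fun t _ => Kc_diag _ (PBP_ne _))
      · rw [Matrix.one_apply_ne (by simpa using hij)]
        by_contra hc
        apply hij
        apply Subtype.ext
        funext t
        have h1 := (Finset.sum_eq_sum_iff_of_le (fun t _ => hle i j hc t)).1
          (hi.trans hj.symm) t (Finset.mem_univ t)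
        rcases (prod_Kc_ne i.1 j.1 hc t).2 with h | h
        · exact h
        · omega
    rw [this, Matrix.det_one]

lemma wrSMat_factor {w : ℕ} (A : T → Q → ℚ) :
    wrSMat A w = (KM T w).map (Int.castRingHom ℚ) * EM A w *
      ((KM Q w).map (Int.castRingHom ℚ)).transpose := by
  ext lam mu
  rw [wrSMat_eq, Matrix.mul_apply]
  simp only [Matrix.mul_apply, Matrix.map_apply, Matrix.transpose_apply, EM, Matrix.of_apply, wg,
    prod_sval, eq_intCast]
  simp only [Finset.sum_mul, Finset.mul_sum]
  rw [Finset.sum_comm]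
  rw [Finset.sum_comm]
  conv_rhs => enter [2, x]; rw [Finset.sum_comm]
  conv_rhs => rw [Finset.sum_comm]
  apply Finset.sum_congr rfl
  intro nu _
  apply Finset.sum_congr rfl
  intro rho _
  apply Finset.sum_congr rfl
  intro kap _
  ring

lemma EM_transpose {w : ℕ} (A : T → Q → ℚ) :
    EM A w = (EM (fun q t => A t q) w).transpose := by
  ext lam mu
  simp only [EM, Matrix.of_apply, Matrix.transpose_apply, wg]
  refine Fintype.sum_equiv (Equiv.arrowCongr (Equiv.prodComm T Q) (Equiv.refl (PBP w))) _ _ ?_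
  intro nu
  have h : ∀ t q, ((Equiv.arrowCongr (Equiv.prodComm T Q) (Equiv.refl (PBP w))) nu
    (q, t)).2.parts = (nu (t, q)).2.parts := fun _ _ => rfl
  simp only [h]
  rw [Finset.prod_comm (s := (Finset.univ : Finset T))]
  ring

end Red

/-! ### The entries as coefficients -/

section Coef

variable {T Q : Type*} [Fintype T] [Fintype Q]

/-- power sums in the block `q` of variables -/
def pq (n : Q → ℕ) (q : Q) (k : ℕ) : MvPolynomial (Σ q, Fin (n q)) ℚ :=
  MvPolynomial.rename (sgm n q) (pw ℚ (n q) k)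

/-- the power sum specialisation attached to the row `t` of `A` -/
def cA (A : T → Q → ℤ) (n : Q → ℕ) (t : T) : ℕ → MvPolynomial (Σ q, Fin (n q)) ℚ :=
  ∑ q, fun k => (A t q : MvPolynomial (Σ q, Fin (n q)) ℚ) * pq n q k

/-- joint exponent vector -/
def exq {w : ℕ} (mu : Q → PBP w) :
    (Σ q, Fin (Multiset.card (mu q).2.parts)) →₀ ℕ :=
  Finsupp.equivFunOnFinite.symm (fun x => exv (mu x.1).2.parts x.2)

lemma eH_const {R : Type*} [CommRing R] [Algebra ℚ R] (a : ℤ) (m : Multiset ℕ) :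
    eH (fun _ => (a : R)) m = algebraMap ℚ R ((a : ℚ) ^ Multiset.card m * (zMult m : ℚ)⁻¹) := by
  unfold eH
  rw [Multiset.map_const', Multiset.prod_replicate, Algebra.smul_def, map_mul, map_pow, mul_comm,
    map_intCast]

lemma coeff_pq {w : ℕ} (mu : Q → PBP w) (m : Q → Multiset ℕ) :
    MvPolynomial.coeff (exq mu)
      (∏ q, ((m q).map (pq (fun q => Multiset.card (mu q).2.parts) q)).prod)
      = ∏ q, (Mcount (mu q).2.parts (m q) : ℚ) := by
  have := coeff_prod_rename (R := ℚ) (n := fun q => Multiset.card (mu q).2.parts)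
    (fun q => ((m q).map (pw ℚ (Multiset.card (mu q).2.parts))).prod)
    (fun q => exv (mu q).2.parts)
  simp only [coeff_pw] at this
  rw [← this]
  unfold exq pq
  congr 1
  apply Finset.prod_congr rfl
  intro q _
  rw [map_multiset_prod, Multiset.map_map]
  rfl

lemma EM_eq {w : ℕ} (A : T → Q → ℤ) (lam : PMapw T w) (mu : PMapw Q w) :
    EM (fun t q => (A t q : ℚ)) w lam mu = MvPolynomial.coeff (exq mu.1)
      (∏ t, ((lam.1 t).2.parts.map (fun k => PowerSeries.coeff k
        (HS (cA A (fun q => Multiset.card (mu.1 q).2.parts) t)))).prod) := by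
  let n : Q → ℕ := fun q => Multiset.card (mu.1 q).2.parts
  have h1 : ∀ t, ((lam.1 t).2.parts.map (fun k => PowerSeries.coeff k (HS (cA A n t)))).prod
      = ∑ nu : Q → PBP w, (Mcount (lam.1 t).2.parts (∑ q, (nu q).2.parts) :
          MvPolynomial (Σ q, Fin (n q)) ℚ) *
        ∏ q, (algebraMap ℚ _ ((A t q : ℚ) ^ Multiset.card (nu q).2.parts *
          (zMult (nu q).2.parts : ℚ)⁻¹) * ((nu q).2.parts.map (pq n q)).prod) := by
    intro t
    unfold cA
    rw [← key_sum _ w]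
    · simp only [eH_mul, eH_const]
    · rw [PBP_sum]
      have := (lam.1 t).1.2
      omega
  refine Eq.trans ?_ (congrArg (MvPolynomial.coeff (exq mu.1))
    (Finset.prod_congr rfl (fun t _ => (h1 t))).symm)
  rw [Fintype.prod_sum, MvPolynomial.coeff_sum]
  simp only [EM, Matrix.of_apply, wg]
  refine Fintype.sum_equiv (Equiv.curry T Q (PBP w)) _ _ ?_
  intro nu
  have h : ∀ t q, (Equiv.curry T Q (PBP w) nu t q).2.parts = (nu (t, q)).2.parts := fun _ _ => rfl
  simp only [h]
  have h2 : (∏ t, ((Mcount (lam.1 t).2.parts (∑ q, (nu (t, q)).2.parts) :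
          MvPolynomial (Σ q, Fin (n q)) ℚ) *
        ∏ q, (algebraMap ℚ (MvPolynomial (Σ q, Fin (n q)) ℚ)
          ((A t q : ℚ) ^ Multiset.card (nu (t, q)).2.parts *
          (zMult (nu (t, q)).2.parts : ℚ)⁻¹) * ((nu (t, q)).2.parts.map (pq n q)).prod)))
      = MvPolynomial.C ((∏ t, (Mcount (lam.1 t).2.parts (∑ q, (nu (t, q)).2.parts) : ℚ)) *
          ∏ t, ∏ q, ((A t q : ℚ) ^ Multiset.card (nu (t, q)).2.parts *
          (zMult (nu (t, q)).2.parts : ℚ)⁻¹)) *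
        ∏ q, ((∑ t, (nu (t, q)).2.parts).map (pq n q)).prod := by
    simp only [MvPolynomial.algebraMap_eq, Finset.prod_mul_distrib, map_mul, map_prod, prod_map_sum,
      map_natCast]
    rw [Finset.prod_comm (s := (Finset.univ : Finset Q)) (t := (Finset.univ : Finset T))
      (f := fun q t => ((nu (t, q)).2.parts.map (pq n q)).prod)]
    ring
  rw [h2, MvPolynomial.coeff_C_mul, coeff_pq]
  ring

end Coef

/-! ### The ring of symmetric functions in several alphabets and its endomorphisms -/

section Endo

set_option linter.unusedSectionVars false

variable {T Q : Type*} [Fintype T] [Fintype Q]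

/-- The generic series. -/
def Hx (t : T) : PowerSeries (MvPolynomial (T × ℕ) ℤ) :=
  PowerSeries.mk fun n => if n = 0 then 1 else MvPolynomial.X (t, n - 1)

lemma Hx_zero (t : T) : PowerSeries.constantCoeff (Hx t) = 1 := by
  rw [← PowerSeries.coeff_zero_eq_constantCoeff_apply]
  simp [Hx]

/-- The generic series as a unit. -/
def HU (t : T) : (PowerSeries (MvPolynomial (T × ℕ) ℤ))ˣ :=
  (PowerSeries.isUnit_iff_constantCoeff.2 (by rw [Hx_zero t]; exact isUnit_one) :
    IsUnit (Hx t)).unit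

lemma HU_coe (t : T) : (HU t : PowerSeries (MvPolynomial (T × ℕ) ℤ)) = Hx t := rfl

/-- evaluation at coefficients of given series. -/
def evG {S : Type*} [CommRing S] (G : T → (PowerSeries S)ˣ) : MvPolynomial (T × ℕ) ℤ →+* S :=
  MvPolynomial.eval₂Hom (Int.castRingHom S)
    (fun x => PowerSeries.coeff (x.2 + 1) (G x.1 : PowerSeries S))

/-- units with constant coefficient one -/
def one1 (S : Type*) [CommRing S] : Subgroup (PowerSeries S)ˣ :=
  (Units.map (PowerSeries.constantCoeff (R := S)).toMonoidHom).ker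

lemma mem_one1 {S : Type*} [CommRing S] (u : (PowerSeries S)ˣ) :
    u ∈ one1 S ↔ PowerSeries.constantCoeff (u : PowerSeries S) = 1 := by
  unfold one1
  rw [MonoidHom.mem_ker, Units.ext_iff]
  rfl

lemma evG_HU {S : Type*} [CommRing S] (G : T → (PowerSeries S)ˣ) (hG : ∀ t, G t ∈ one1 S) (t : T) :
    Units.map (PowerSeries.map (evG G)).toMonoidHom (HU t) = G t := by
  apply Units.ext
  show PowerSeries.map (evG G) (Hx t) = G t
  ext n
  rw [PowerSeries.coeff_map, Hx, PowerSeries.coeff_mk]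
  rcases n with _ | n
  · rw [PowerSeries.coeff_zero_eq_constantCoeff_apply, (mem_one1 _).1 (hG t)]
    simp
  · simp [evG]

/-- action of integer matrices on families of units. -/
def mact {M : Type*} [CommGroup M] (U : Matrix T Q ℤ) (G : Q → M) (t : T) : M :=
  ∏ s, G s ^ U t s

lemma prod_zpow_sum {M ι : Type*} [CommGroup M] (g : M) (s : Finset ι) (f : ι → ℤ) :
    ∏ i ∈ s, g ^ f i = g ^ ∑ i ∈ s, f i := by
  induction s using Finset.induction_on with
  | empty => simp
  | insert a s ha ih => rw [Finset.prod_insert ha, Finset.sum_insert ha, ih, zpow_add]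

lemma mact_mact {M : Type*} [CommGroup M] (U V : Matrix T T ℤ) (G : T → M) :
    mact U (mact V G) = mact (U * V) G := by
  funext t
  unfold mact
  simp only [← Finset.prod_zpow]
  rw [Finset.prod_comm]
  apply Finset.prod_congr rfl
  intro r _
  simp only [← zpow_mul, Matrix.mul_apply]
  rw [← prod_zpow_sum]
  apply Finset.prod_congr rfl
  intro s _
  rw [mul_comm]

lemma mact_one {M : Type*} [CommGroup M] (G : T → M) : mact (1 : Matrix T T ℤ) G = G := by
  funext t
  unfold mact
  rw [Finset.prod_eq_single t]
  · simp
  · intro s _ hs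
    rw [Matrix.one_apply_ne hs.symm, zpow_zero]
  · simp

lemma mact_mem {M : Type*} [CommGroup M] (H : Subgroup M) (U : Matrix T T ℤ) (G : T → M)
    (hG : ∀ t, G t ∈ H) (t : T) : mact U G t ∈ H :=
  Subgroup.prod_mem _ fun s _ => Subgroup.zpow_mem _ (hG s) _

lemma mact_map {M N : Type*} [CommGroup M] [CommGroup N] (f : M →* N) (U : Matrix T T ℤ)
    (G : T → M) (t : T) : f (mact U G t) = mact U (fun s => f (G s)) t := by
  unfold mact
  rw [map_prod]
  simp

/-- The endomorphism attached to a matrix. -/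
def Ph (U : Matrix T T ℤ) : MvPolynomial (T × ℕ) ℤ →+* MvPolynomial (T × ℕ) ℤ :=
  evG (mact U HU)

lemma HU_mem (t : T) : HU t ∈ one1 (MvPolynomial (T × ℕ) ℤ) := (mem_one1 _).2 (Hx_zero t)

lemma evG_Ph {S : Type*} [CommRing S] (G : T → (PowerSeries S)ˣ) (hG : ∀ t, G t ∈ one1 S)
    (U : Matrix T T ℤ) : (evG G).comp (Ph U) = evG (mact U G) := by
  apply MvPolynomial.ringHom_ext
  · intro r
    simp
  · rintro ⟨t, n⟩
    have h1 := mact_map (Units.map (PowerSeries.map (evG G)).toMonoidHom) U HU t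
    simp only [evG_HU G hG] at h1
    have h2 : PowerSeries.map (evG G) (mact U HU t : (PowerSeries (MvPolynomial (T × ℕ) ℤ))ˣ)
        = (mact U G t : (PowerSeries S)ˣ) := congrArg Units.val h1
    have h3 := congrArg (PowerSeries.coeff (n + 1)) h2
    rw [PowerSeries.coeff_map] at h3
    simp only [RingHom.comp_apply]
    have h4 : Ph U (MvPolynomial.X (t, n)) = PowerSeries.coeff (n + 1)
        ((mact U HU t : (PowerSeries (MvPolynomial (T × ℕ) ℤ))ˣ) : PowerSeries _) := by
      simp [Ph, evG]
    rw [h4, h3]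
    simp [evG]

lemma evG_HU_id : evG (HU (T := T)) = RingHom.id _ := by
  apply MvPolynomial.ringHom_ext
  · intro r
    simp
  · rintro ⟨t, n⟩
    simp [evG, HU_coe, Hx]

lemma Ph_one : Ph (1 : Matrix T T ℤ) = RingHom.id _ := by
  unfold Ph
  rw [mact_one, evG_HU_id]

lemma Ph_mul (U V : Matrix T T ℤ) : Ph (U * V) = (Ph V).comp (Ph U) := by
  conv_rhs => rw [Ph]
  rw [evG_Ph _ (mact_mem _ V HU HU_mem), mact_mact]
  rfl

/-! weighted homogeneity -/

/-- weights -/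
def wt (x : T × ℕ) : ℕ := x.2 + 1

/-- homogeneous series -/
def HomS (f : PowerSeries (MvPolynomial (T × ℕ) ℤ)) : Prop :=
  ∀ n, MvPolynomial.IsWeightedHomogeneous wt (PowerSeries.coeff n f) n

lemma HomS_mul {f g : PowerSeries (MvPolynomial (T × ℕ) ℤ)} (hf : HomS f) (hg : HomS g) :
    HomS (f * g) := by
  intro n
  rw [PowerSeries.coeff_mul]
  apply MvPolynomial.IsWeightedHomogeneous.sum
  rintro ⟨i, j⟩ h
  rw [Finset.HasAntidiagonal.mem_antidiagonal] at h
  have := (hf i).mul (hg j)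
  simp only at h
  rw [h] at this
  exact this

lemma HomS_one : HomS (1 : PowerSeries (MvPolynomial (T × ℕ) ℤ)) := by
  intro n
  rw [PowerSeries.coeff_one]
  split_ifs with h
  · rw [h]; exact MvPolynomial.isWeightedHomogeneous_one _ _
  · exact MvPolynomial.isWeightedHomogeneous_zero _ _ _

lemma HomS_inv {f g : PowerSeries (MvPolynomial (T × ℕ) ℤ)} (hf : HomS f) (h : f * g = 1)
    (h0 : PowerSeries.coeff 0 f = 1) : HomS g := by
  intro n
  induction n using Nat.strong_induction_on with
  | _ n ih =>
    have h1 := congrArg (PowerSeries.coeff n) h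
    rw [PowerSeries.coeff_mul, Finset.Nat.sum_antidiagonal_eq_sum_range_succ_mk,
      Finset.sum_range_succ'] at h1
    simp only [h0, one_mul, Nat.sub_zero] at h1
    rw [← eq_sub_iff_add_eq'] at h1
    rw [h1]
    apply MvPolynomial.IsWeightedHomogeneous.sub
    · exact HomS_one n
    · apply MvPolynomial.IsWeightedHomogeneous.sum
      intro i hi
      rw [Finset.mem_range] at hi
      have := (hf (i + 1)).mul (ih (n - (i + 1)) (by omega))
      rwa [show i + 1 + (n - (i + 1)) = n by omega] at this

/-- the group of homogeneous units -/
def HomG (T : Type*) [Fintype T] : Subgroup (PowerSeries (MvPolynomial (T × ℕ) ℤ))ˣ where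
  carrier := {u | HomS (u : PowerSeries (MvPolynomial (T × ℕ) ℤ)) ∧
    HomS ((u⁻¹ : (PowerSeries (MvPolynomial (T × ℕ) ℤ))ˣ) : PowerSeries (MvPolynomial (T × ℕ) ℤ))}
  one_mem' := ⟨HomS_one, by rw [inv_one]; exact HomS_one⟩
  mul_mem' := by
    rintro a b ⟨ha, ha'⟩ ⟨hb, hb'⟩
    refine ⟨HomS_mul ha hb, ?_⟩
    rw [mul_inv]
    exact HomS_mul ha' hb'
  inv_mem' := by
    rintro a ⟨ha, ha'⟩
    refine ⟨ha', ?_⟩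
    rw [inv_inv]
    exact ha

lemma HU_HomG (t : T) : HU t ∈ HomG T := by
  have h : HomS (Hx t) := by
    intro n
    rw [Hx, PowerSeries.coeff_mk]
    split_ifs with h
    · rw [h]; exact MvPolynomial.isWeightedHomogeneous_one _ _
    · have := MvPolynomial.isWeightedHomogeneous_X ℤ (wt (T := T)) (t, n - 1)
      rwa [show wt (t, n - 1) = n by unfold wt; simp only; omega] at this
  refine ⟨h, HomS_inv h (Units.mul_inv (HU t)) ?_⟩
  simp [Hx]

end Endo

/-! ### Monomials and the final argument -/

section Fin8

set_option linter.unusedSectionVars false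

variable {T Q : Type*} [Fintype T] [Fintype Q]

/-- the multiset of variables attached to a family of partitions. -/
def msT {w : ℕ} (lam : T → PBP w) : Multiset (T × ℕ) :=
  ∑ t, (lam t).2.parts.map (fun k => (t, k - 1))

/-- recovering the partition at `t`. -/
def recH (t : T) : Multiset (T × ℕ) →+ Multiset ℕ where
  toFun s := (s.filter (fun x => x.1 = t)).map (fun x => x.2 + 1)
  map_zero' := by simp
  map_add' := by intro a b; simp

lemma recH_apply (t : T) (s : Multiset (T × ℕ)) :
    recH t s = (s.filter (fun x => x.1 = t)).map (fun x => x.2 + 1) := rfl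

lemma recH_msT {w : ℕ} (lam : T → PBP w) (t : T) : recH t (msT lam) = (lam t).2.parts := by
  unfold msT
  rw [map_sum, Finset.sum_eq_single t]
  · rw [recH_apply]
    rw [Multiset.filter_eq_self.2, Multiset.map_map]
    · conv_rhs => rw [← Multiset.map_id (lam t).2.parts]
      apply Multiset.map_congr rfl
      intro x hx
      have := PBP_ne _ x hx
      simp only [Function.comp_apply, id]
      omega
    · intro x hx
      rw [Multiset.mem_map] at hx
      obtain ⟨k, _, rfl⟩ := hx
      rfl
  · intro s _ hs
    rw [recH_apply]
    rw [Multiset.filter_eq_nil.2, Multiset.map_zero]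
    intro x hx
    rw [Multiset.mem_map] at hx
    obtain ⟨k, _, rfl⟩ := hx
    exact hs
  · simp

lemma msT_inj {w : ℕ} {lam kap : T → PBP w} (h : msT lam = msT kap) : lam = kap := by
  funext t
  apply PBP_ext
  rw [← recH_msT, ← recH_msT, h]

lemma sum_recH (s : Multiset (T × ℕ)) :
    ∑ t, (recH t s).map (fun k => (t, k - 1)) = s := by
  induction s using Multiset.induction_on with
  | empty => simp
  | cons a s ih =>
    conv_rhs => rw [← ih]
    rw [← Multiset.singleton_add]
    simp only [map_add, Multiset.map_add]
    rw [Finset.sum_add_distrib]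
    congr 1
    rw [Finset.sum_eq_single a.1]
    · simp [recH_apply, Multiset.filter_singleton]
    · intro t _ ht
      simp [recH_apply, Multiset.filter_singleton, ht.symm]
    · simp

lemma sum_recH_sum (s : Multiset (T × ℕ)) : ∑ t, (recH t s).sum = (s.map wt).sum := by
  induction s using Multiset.induction_on with
  | empty => simp
  | cons a s ih =>
    rw [← Multiset.singleton_add]
    simp only [map_add, Multiset.map_add, Multiset.sum_add]
    rw [Finset.sum_add_distrib, ih]
    congr 1
    rw [Finset.sum_eq_single a.1]
    · simp [recH_apply, Multiset.filter_singleton, wt]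
    · intro t _ ht
      simp [recH_apply, Multiset.filter_singleton, ht.symm]
    · simp

lemma msT_surj {w : ℕ} (s : Multiset (T × ℕ)) (h : (s.map wt).sum = w) :
    ∃ lam : PMapw T w, msT lam.1 = s := by
  have h1 : ∀ t, ∃ p : PBP w, p.2.parts = recH t s := by
    intro t
    apply PBP_exists
    · intro x hx
      rw [recH_apply, Multiset.mem_map] at hx
      obtain ⟨k, _, rfl⟩ := hx
      omega
    · rw [← h, ← sum_recH_sum]
      exact Finset.single_le_sum (f := fun t => (recH t s).sum) (fun _ _ => Nat.zero_le _)
        (Finset.mem_univ t)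
  choose lam hlam using h1
  refine ⟨⟨lam, ?_⟩, ?_⟩
  · refine Eq.trans ?_ ((sum_recH_sum s).trans h)
    apply Finset.sum_congr rfl
    intro t _
    rw [← hlam t]
    exact (PBP_sum _).symm
  · unfold msT
    simp only [hlam]
    exact sum_recH s

/-- exponent vector -/
def ex {w : ℕ} (lam : T → PBP w) : T × ℕ →₀ ℕ := Multiset.toFinsupp (msT lam)

/-- monomial attached to a family of partitions -/
def mon {w : ℕ} (lam : T → PBP w) : MvPolynomial (T × ℕ) ℤ := MvPolynomial.monomial (ex lam) 1

lemma ex_inj {w : ℕ} {lam kap : PMapw T w} (h : ex lam.1 = ex kap.1) : lam = kap :=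
  Subtype.ext (msT_inj (Multiset.toFinsupp.injective h))

lemma monomial_toFinsupp (s : Multiset (T × ℕ)) :
    MvPolynomial.monomial (Multiset.toFinsupp s) (1 : ℤ) = (s.map MvPolynomial.X).prod := by
  induction s using Multiset.induction_on with
  | empty => simp
  | cons a s ih =>
    rw [Multiset.map_cons, Multiset.prod_cons, ← ih, ← Multiset.singleton_add, map_add,
      Multiset.toFinsupp_singleton, MvPolynomial.X, MvPolynomial.monomial_mul, mul_one]

lemma weight_toFinsupp (s : Multiset (T × ℕ)) :
    Finsupp.weight wt (Multiset.toFinsupp s) = (s.map wt).sum := by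
  induction s using Multiset.induction_on with
  | empty => simp
  | cons a s ih =>
    rw [Multiset.map_cons, Multiset.sum_cons, ← ih, ← Multiset.singleton_add, map_add, map_add,
      Multiset.toFinsupp_singleton, Finsupp.weight_single]
    simp

lemma mon_eq {w : ℕ} (lam : T → PBP w) :
    mon lam = ∏ t, ((lam t).2.parts.map (fun k => MvPolynomial.X (t, k - 1))).prod := by
  unfold mon ex
  rw [monomial_toFinsupp]
  unfold msT
  have : ∀ s : Finset T, ((∑ t ∈ s, (lam t).2.parts.map (fun k => (t, k - 1))).map
      (MvPolynomial.X (R := ℤ))).prod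
      = ∏ t ∈ s, ((lam t).2.parts.map (fun k => MvPolynomial.X (t, k - 1))).prod := by
    intro s
    induction s using Finset.induction_on with
    | empty => simp
    | insert a s ha ih =>
      rw [Finset.sum_insert ha, Finset.prod_insert ha, Multiset.map_add, Multiset.prod_add, ih,
        Multiset.map_map]
      rfl
  exact this _

lemma evG_mon {S : Type*} [CommRing S] (G : T → (PowerSeries S)ˣ) {w : ℕ} (lam : T → PBP w) :
    evG G (mon lam) = ∏ t, ((lam t).2.parts.map
      (fun k => PowerSeries.coeff k (G t : PowerSeries S))).prod := by
  rw [mon_eq, map_prod]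
  apply Finset.prod_congr rfl
  intro t _
  rw [map_multiset_prod, Multiset.map_map]
  congr 1
  apply Multiset.map_congr rfl
  intro k hk
  have hk' := PBP_ne _ k hk
  have : k - 1 + 1 = k := by omega
  simp [evG, this]

lemma wh_multiset (m : Multiset ℕ) (f : ℕ → MvPolynomial (T × ℕ) ℤ)
    (hf : ∀ k, MvPolynomial.IsWeightedHomogeneous wt (f k) k) :
    MvPolynomial.IsWeightedHomogeneous wt (m.map f).prod m.sum := by
  induction m using Multiset.induction_on with
  | empty => simpa using MvPolynomial.isWeightedHomogeneous_one ℤ wt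
  | cons a s ih =>
    rw [Multiset.map_cons, Multiset.prod_cons, Multiset.sum_cons]
    exact (hf a).mul ih

lemma Ph_mon_wh {w : ℕ} (U : Matrix T T ℤ) (lam : PMapw T w) :
    MvPolynomial.IsWeightedHomogeneous wt (Ph U (mon lam.1)) w := by
  unfold Ph
  rw [evG_mon]
  have := MvPolynomial.IsWeightedHomogeneous.prod (w := wt) Finset.univ
    (fun t => ((lam.1 t).2.parts.map (fun k => PowerSeries.coeff k
      ((mact U HU t : (PowerSeries (MvPolynomial (T × ℕ) ℤ))ˣ) :
        PowerSeries (MvPolynomial (T × ℕ) ℤ)))).prod)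
    (fun t => (lam.1 t).2.parts.sum)
    (fun t _ => wh_multiset _ _ (fun k => (mact_mem (HomG T) U HU HU_HomG t).1 k))
  simp only [PBP_sum] at this
  rw [lam.2] at this
  exact this

lemma wh_expand {w : ℕ} (p : MvPolynomial (T × ℕ) ℤ)
    (hp : MvPolynomial.IsWeightedHomogeneous wt p w) :
    p = ∑ kap : PMapw T w, MvPolynomial.C (MvPolynomial.coeff (ex kap.1) p) * mon kap.1 := by
  ext d
  rw [MvPolynomial.coeff_sum]
  simp only [MvPolynomial.coeff_C_mul, mon, MvPolynomial.coeff_monomial]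
  by_cases hd : ∃ kap : PMapw T w, ex kap.1 = d
  · obtain ⟨kap, rfl⟩ := hd
    rw [Finset.sum_eq_single kap]
    · simp
    · intro r _ hr
      rw [if_neg (fun h => hr (ex_inj h)), mul_zero]
    · simp
  · rw [Finset.sum_eq_zero]
    · by_contra hc
      apply hd
      have h1 := hp hc
      obtain ⟨s, rfl⟩ := Multiset.toFinsupp.surjective d
      rw [weight_toFinsupp] at h1
      obtain ⟨lam, hlam⟩ := msT_surj s h1
      exact ⟨lam, by rw [ex, hlam]⟩
    · intro kap _
      rw [if_neg (fun h => hd ⟨kap, h⟩), mul_zero]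

/-- the matrix of `Ph U` in weight `w`. -/
def PM (U : Matrix T T ℤ) (w : ℕ) : Matrix (PMapw T w) (PMapw T w) ℤ :=
  Matrix.of fun lam kap => MvPolynomial.coeff (ex kap.1) (Ph U (mon lam.1))

lemma Ph_mon {w : ℕ} (U : Matrix T T ℤ) (lam : PMapw T w) :
    Ph U (mon lam.1) = ∑ kap, MvPolynomial.C (PM U w lam kap) * mon kap.1 :=
  wh_expand _ (Ph_mon_wh U lam)

lemma PM_one (w : ℕ) : PM (1 : Matrix T T ℤ) w = 1 := by
  ext lam kap
  rw [PM, Matrix.of_apply, Ph_one, RingHom.id_apply, mon, MvPolynomial.coeff_monomial,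
    Matrix.one_apply]
  congr 1
  rw [eq_iff_iff]
  exact ⟨ex_inj, fun h => by rw [h]⟩

lemma PM_mul (U V : Matrix T T ℤ) (w : ℕ) : PM (U * V) w = PM U w * PM V w := by
  ext lam kap
  rw [Matrix.mul_apply, PM, Matrix.of_apply, Ph_mul, RingHom.comp_apply, Ph_mon, map_sum,
    MvPolynomial.coeff_sum]
  apply Finset.sum_congr rfl
  intro rho _
  have : Ph V (MvPolynomial.C (PM U w lam rho)) = MvPolynomial.C (PM U w lam rho) := by
    simp
  rw [map_mul, this, MvPolynomial.coeff_C_mul]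
  rfl

lemma PM_unit (U : Matrix T T ℤ) (w : ℕ) (hU : IsUnit U) : IsUnit (PM U w) := by
  obtain ⟨u, rfl⟩ := hU
  refine isUnit_iff_exists.2 ⟨PM ((u⁻¹ : (Matrix T T ℤ)ˣ) : Matrix T T ℤ) w, ?_, ?_⟩
  · rw [← PM_mul, Units.mul_inv, PM_one]
  · rw [← PM_mul, Units.inv_mul, PM_one]

lemma cA_mul (U : Matrix T T ℤ) (A : Matrix T Q ℤ) (n : Q → ℕ) (t : T) :
    cA (U * A) n t = ∑ s, U t s • cA A n s := by
  funext k
  simp only [cA, Finset.sum_apply, Pi.smul_apply, Matrix.mul_apply, Finset.smul_sum]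
  rw [Finset.sum_comm]
  apply Finset.sum_congr rfl
  intro q _
  push_cast
  rw [Finset.sum_mul]
  apply Finset.sum_congr rfl
  intro s _
  rw [zsmul_eq_mul]
  ring

/-- the series attached to the rows of `A` as units -/
def GA (A : Matrix T Q ℤ) (n : Q → ℕ) (t : T) :
    (PowerSeries (MvPolynomial (Σ q, Fin (n q)) ℚ))ˣ :=
  HSHom (Multiplicative.ofAdd (cA A n t))

lemma GA_mul (U : Matrix T T ℤ) (A : Matrix T Q ℤ) (n : Q → ℕ) :
    GA (U * A) n = mact U (GA A n) := by
  funext t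
  unfold GA mact
  rw [cA_mul, ofAdd_sum, map_prod]
  simp only [ofAdd_zsmul, map_zpow]

lemma GA_mem (A : Matrix T Q ℤ) (n : Q → ℕ) (t : T) : GA A n t ∈ one1 _ := by
  rw [mem_one1]
  unfold GA
  rw [HSHom_coe, ← PowerSeries.coeff_zero_eq_constantCoeff_apply, HS_zero_coeff]

lemma EM_eq' {w : ℕ} (A : Matrix T Q ℤ) (lam : PMapw T w) (mu : PMapw Q w) :
    EM (fun t q => (A t q : ℚ)) w lam mu = MvPolynomial.coeff (exq mu.1)
      (evG (GA A (fun q => Multiset.card (mu.1 q).2.parts)) (mon lam.1)) := by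
  refine (EM_eq (fun t q => A t q) lam mu).trans ?_
  rw [evG_mon]
  rfl

lemma EM_mul {w : ℕ} (U : Matrix T T ℤ) (A : Matrix T Q ℤ) :
    EM (fun t q => ((U * A) t q : ℚ)) w
      = (PM U w).map (Int.castRingHom ℚ) * EM (fun t q => (A t q : ℚ)) w := by
  ext lam mu
  rw [EM_eq', GA_mul, ← evG_Ph _ (GA_mem _ _), RingHom.comp_apply, Ph_mon, map_sum,
    MvPolynomial.coeff_sum, Matrix.mul_apply]
  apply Finset.sum_congr rfl
  intro kap _
  rw [EM_eq', map_mul, Matrix.map_apply]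
  have : evG (GA A (fun q => Multiset.card (mu.1 q).2.parts)) (MvPolynomial.C (PM U w lam kap))
      = MvPolynomial.C (PM U w lam kap : ℚ) := by
    simp
  rw [this, MvPolynomial.coeff_C_mul]
  rfl

lemma EM_equiv {w : ℕ} (U : Matrix T T ℤ) (V : Matrix Q Q ℤ) (A : Matrix T Q ℤ) :
    EM (fun t q => ((U * A * V) t q : ℚ)) w
      = (PM U w).map (Int.castRingHom ℚ) * EM (fun t q => (A t q : ℚ)) w *
        ((PM V.transpose w).transpose).map (Int.castRingHom ℚ) := by
  have h1 : EM (fun t q => ((A * V) t q : ℚ)) w = EM (fun t q => (A t q : ℚ)) w *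
        ((PM V.transpose w).transpose).map (Int.castRingHom ℚ) := by
    have h2 := EM_mul (w := w) V.transpose A.transpose
    rw [← Matrix.transpose_mul] at h2
    rw [EM_transpose, EM_transpose (fun t q => (A t q : ℚ))]
    simp only [Matrix.transpose_apply] at h2
    rw [h2, Matrix.transpose_mul, Matrix.transpose_map]
  rw [Matrix.mul_assoc, EM_mul, h1, Matrix.mul_assoc]

end Fin8

/-- **Proposition 3.12.** If the integer `T × Q`-matrices `A` and `B` are equivalent over `ℤ`,
then `A^{≀w}(s,s)` and `B^{≀w}(s,s)` are equivalent over `ℤ`. -/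
theorem wr_equiv {T Q : Type*} [Fintype T] [Fintype Q] (w : ℕ) (A B : Matrix T Q ℤ)
    (h : ∃ (U : Matrix T T ℤ) (V : Matrix Q Q ℤ), IsUnit U ∧ IsUnit V ∧ B = U * A * V) :
    ∃ (U' : Matrix (PMapw T w) (PMapw T w) ℤ) (V' : Matrix (PMapw Q w) (PMapw Q w) ℤ),
      IsUnit U' ∧ IsUnit V' ∧
        wrSMat (fun t q => (B t q : ℚ)) w
          = U'.map (fun x : ℤ => (x : ℚ)) * wrSMat (fun t q => (A t q : ℚ)) w *
              V'.map (fun x : ℤ => (x : ℚ)) := by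
  obtain ⟨U, V, hU, hV, rfl⟩ := h
  obtain ⟨k, hk⟩ := KM_unit T w
  obtain ⟨l, hl⟩ := KM_unit Q w
  have hVt : IsUnit V.transpose := by
    rw [Matrix.isUnit_iff_isUnit_det, Matrix.det_transpose, ← Matrix.isUnit_iff_isUnit_det]
    exact hV
  have htr : ∀ M : Matrix (PMapw Q w) (PMapw Q w) ℤ, IsUnit M → IsUnit M.transpose := by
    intro M hM
    rw [Matrix.isUnit_iff_isUnit_det, Matrix.det_transpose, ← Matrix.isUnit_iff_isUnit_det]
    exact hM
  let ki : Matrix (PMapw T w) (PMapw T w) ℤ :=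
    ((k⁻¹ : (Matrix (PMapw T w) (PMapw T w) ℤ)ˣ) : Matrix (PMapw T w) (PMapw T w) ℤ)
  let li : Matrix (PMapw Q w) (PMapw Q w) ℤ :=
    ((l⁻¹ : (Matrix (PMapw Q w) (PMapw Q w) ℤ)ˣ) : Matrix (PMapw Q w) (PMapw Q w) ℤ)
  have hki : ki * KM T w = 1 := by rw [← hk]; exact Units.inv_mul k
  have hli : (KM Q w).transpose * li.transpose = 1 := by
    rw [← Matrix.transpose_mul, ← hl]
    show (li * l).transpose = 1
    rw [show li * (l : Matrix (PMapw Q w) (PMapw Q w) ℤ) = 1 from Units.inv_mul l,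
      Matrix.transpose_one]
  refine ⟨KM T w * PM U w * ki,
    li.transpose * (PM V.transpose w).transpose * (KM Q w).transpose, ?_, ?_, ?_⟩
  · exact ((KM_unit T w).mul (PM_unit U w hU)).mul (Units.isUnit _)
  · exact ((htr _ (Units.isUnit _)).mul (htr _ (PM_unit _ w hVt))).mul (htr _ (KM_unit Q w))
  · have hc : (fun x : ℤ => (x : ℚ)) = Int.castRingHom ℚ := rfl
    rw [wrSMat_factor, wrSMat_factor, EM_equiv, hc]
    simp only [Matrix.map_mul]
    have h1 : ki.map (Int.castRingHom ℚ) * (KM T w).map (Int.castRingHom ℚ) = 1 := by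
      rw [← Matrix.map_mul, hki, Matrix.map_one _ (map_zero _) (map_one _)]
    have h2 : ((KM Q w).transpose).map (Int.castRingHom ℚ) *
        (li.transpose).map (Int.castRingHom ℚ) = 1 := by
      rw [← Matrix.map_mul, hli, Matrix.map_one _ (map_zero _) (map_one _)]
    rw [← Matrix.transpose_map (M := KM Q w)]
    generalize (KM T w).map (Int.castRingHom ℚ) = K at *
    generalize ((KM Q w).transpose).map (Int.castRingHom ℚ) = L at *
    generalize (li.transpose).map (Int.castRingHom ℚ) = Li at *
    generalize ki.map (Int.castRingHom ℚ) = Ki at *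
    simp only [Matrix.mul_assoc]
    rw [← Matrix.mul_assoc L Li, h2, Matrix.one_mul, ← Matrix.mul_assoc Ki K, h1, Matrix.one_mul]

end
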